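/- arXiv:2312.04130 — 2 statements merged into one kernel-verified Lean document; each statement's English description precedes it below -/
import Mathlib

section
/- Let d ≥ 3, ξ₀ = (π/2, …, π/2) ∈ ℝ^d and v₀ = (1/√(2d), …, 1/√(2d)) ∈ ℝ^d. Then there exist an invertible linear map Φ : ℝ^d → ℝ^d, a constant c ∈ ℝ, a radius ρ > 0 and a function R : B_{ℝ^d}(0,ρ) → ℝ which is real-analytic with R(0) = 0 and whose Taylor coefficient at 0 of multi-index γ ∈ ℕ^d vanishes whenever γ·w_d ≤ 1, where w_d = (1/3, …, 1/3, 1/2), such that for all v ∈ ℝ^d and all y = (y_1,…,y_d) ∈ B_{ℝ^d}(0,ρ): φ(v, Φ(y) + ξ₀) = c + v·ξ₀ + (v − v₀)·Φ(y) + y_d² + (∑_{j=1}^{d−1} y_j)³ − ∑_{j=1}^{d−1} y_j³ + R(y). -/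
open MeasureTheory

/-- `ω(ξ) = (∑ (2 - 2cos ξ_j))^{1/2}` -/
noncomputable def discOmega (d : ℕ) (ξ : Fin d → ℝ) : ℝ :=
  Real.sqrt (∑ j, (2 - 2 * Real.cos (ξ j)))

/-- the partial derivative `∂_i f`. -/
noncomputable def pderivAt (d : ℕ) (i : Fin d) (f : (Fin d → ℝ) → ℝ) : (Fin d → ℝ) → ℝ :=
  fun x => fderiv ℝ f x (Pi.single i 1)

/-- the iterated partial derivative `∂^γ f` of multi-index `γ`. -/
noncomputable def multiDeriv (d : ℕ) (γ : Fin d → ℕ) (f : (Fin d → ℝ) → ℝ) :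
    (Fin d → ℝ) → ℝ :=
  (List.finRange d).foldr (fun i g => (pderivAt d i)^[γ i] g) f

open Filter Topology

section WeightedVanishing

variable {d : ℕ} {w : Fin d → ℕ} {m n : ℕ} {f g : (Fin d → ℝ) → ℝ}

/-- `f` is analytic at `0` and all its iterated partial derivatives whose total weight is less
than `n` vanish at `0`, where differentiating in direction `i` has weight `w i`. -/
def WeightedVanishing (w : Fin d → ℕ) (n : ℕ) (f : (Fin d → ℝ) → ℝ) : Prop :=
  AnalyticAt ℝ f 0 ∧ ∀ l : List (Fin d), (l.map w).sum < n →
    l.foldl (fun g i => pderivAt d i g) f 0 = 0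

theorem AnalyticAt.pderivAt {x : Fin d → ℝ} (hf : AnalyticAt ℝ f x) (i : Fin d) :
    AnalyticAt ℝ (pderivAt d i f) x :=
  ((ContinuousLinearMap.apply ℝ ℝ (Pi.single i 1 : Fin d → ℝ)).analyticAt _).comp hf.fderiv

theorem Filter.EventuallyEq.pderivAt {x : Fin d → ℝ} (h : f =ᶠ[𝓝 x] g) (i : Fin d) :
    pderivAt d i f =ᶠ[𝓝 x] pderivAt d i g :=
  (h.fderiv (𝕜 := ℝ)).mono fun y hy => by simp only [_root_.pderivAt, hy]

theorem pderivAt_add_eventuallyEq {x : Fin d → ℝ} (hf : AnalyticAt ℝ f x)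
    (hg : AnalyticAt ℝ g x) (i : Fin d) :
    pderivAt d i (fun y => f y + g y) =ᶠ[𝓝 x] fun y => pderivAt d i f y + pderivAt d i g y := by
  filter_upwards [hf.eventually_analyticAt, hg.eventually_analyticAt] with y hfy hgy
  simp only [pderivAt]
  rw [fderiv_fun_add hfy.differentiableAt hgy.differentiableAt]
  rfl

theorem pderivAt_mul_eventuallyEq {x : Fin d → ℝ} (hf : AnalyticAt ℝ f x)
    (hg : AnalyticAt ℝ g x) (i : Fin d) :
    pderivAt d i (fun y => f y * g y) =ᶠ[𝓝 x]
      fun y => pderivAt d i f y * g y + f y * pderivAt d i g y := by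
  filter_upwards [hf.eventually_analyticAt, hg.eventually_analyticAt] with y hfy hgy
  simp only [pderivAt]
  rw [fderiv_fun_mul hfy.differentiableAt hgy.differentiableAt]
  simp only [add_apply, smul_apply, smul_eq_mul]
  ring

theorem foldl_pderivAt_congr {x : Fin d → ℝ} (l : List (Fin d)) (h : f =ᶠ[𝓝 x] g) :
    l.foldl (fun g i => pderivAt d i g) f =ᶠ[𝓝 x] l.foldl (fun g i => pderivAt d i g) g := by
  induction l generalizing f g with
  | nil => exact h
  | cons i l ih => exact ih (h.pderivAt i)

theorem foldl_pderivAt_add {x : Fin d → ℝ} (l : List (Fin d)) (hf : AnalyticAt ℝ f x)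
    (hg : AnalyticAt ℝ g x) :
    l.foldl (fun g i => pderivAt d i g) (fun y => f y + g y) x =
      l.foldl (fun g i => pderivAt d i g) f x + l.foldl (fun g i => pderivAt d i g) g x := by
  induction l generalizing f g with
  | nil => rfl
  | cons i l ih =>
    simp only [List.foldl_cons]
    rw [(foldl_pderivAt_congr l (pderivAt_add_eventuallyEq hf hg i)).eq_of_nhds,
      ih (hf.pderivAt i) (hg.pderivAt i)]

namespace WeightedVanishing

theorem of_analyticAt (hf : AnalyticAt ℝ f 0) : WeightedVanishing w 0 f :=
  ⟨hf, fun _ h => absurd h (Nat.not_lt_zero _)⟩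

theorem mono (hf : WeightedVanishing w n f) (h : m ≤ n) : WeightedVanishing w m f :=
  ⟨hf.1, fun l hl => hf.2 l (hl.trans_le h)⟩

theorem congr (hf : WeightedVanishing w n f) (h : f =ᶠ[𝓝 0] g) : WeightedVanishing w n g :=
  ⟨hf.1.congr h, fun l hl => by rw [← (foldl_pderivAt_congr l h).eq_of_nhds, hf.2 l hl]⟩

theorem apply_zero (hf : WeightedVanishing w n f) (h : 0 < n) : f 0 = 0 :=
  hf.2 [] h

theorem pderivAt (hf : WeightedVanishing w n f) (i : Fin d) :
    WeightedVanishing w (n - w i) (pderivAt d i f) :=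
  ⟨hf.1.pderivAt i, fun l hl => hf.2 (i :: l) (by simp only [List.map_cons, List.sum_cons]; omega)⟩

theorem of_pderivAt (hf : AnalyticAt ℝ f 0) (h0 : f 0 = 0)
    (h : ∀ i, WeightedVanishing w (n - w i) (_root_.pderivAt d i f)) :
    WeightedVanishing w n f := by
  refine ⟨hf, fun l hl => ?_⟩
  cases l with
  | nil => exact h0
  | cons i l => exact (h i).2 l (by simp only [List.map_cons, List.sum_cons] at hl; omega)

theorem zero : WeightedVanishing w n (fun _ => 0) := by
  refine ⟨analyticAt_const, fun l _ => ?_⟩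
  induction l with
  | nil => rfl
  | cons i l ih =>
    have : _root_.pderivAt d i (fun _ => 0) = fun _ => 0 := by
      funext y
      simp [_root_.pderivAt]
    rw [List.foldl_cons, this]
    exact ih (by simp_all; omega)

theorem add (hf : WeightedVanishing w n f) (hg : WeightedVanishing w n g) :
    WeightedVanishing w n (fun y => f y + g y) :=
  ⟨hf.1.add hg.1, fun l hl => by
    rw [foldl_pderivAt_add l hf.1 hg.1, hf.2 l hl, hg.2 l hl, add_zero]⟩

theorem mul (hf : WeightedVanishing w m f) (hg : WeightedVanishing w n g) :
    WeightedVanishing w (m + n) (fun y => f y * g y) := by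
  refine ⟨hf.1.mul hg.1, fun l hl => ?_⟩
  induction l generalizing m n f g with
  | nil =>
    simp only [List.map_nil, List.sum_nil] at hl
    rcases Nat.eq_zero_or_pos m with rfl | hm
    · simp [hg.apply_zero (by omega)]
    · simp [hf.apply_zero hm]
  | cons i l ih =>
    simp only [List.map_cons, List.sum_cons] at hl
    rw [List.foldl_cons,
      (foldl_pderivAt_congr l (pderivAt_mul_eventuallyEq hf.1 hg.1 i)).eq_of_nhds,
      foldl_pderivAt_add l ((hf.1.pderivAt i).fun_mul hg.1) (hf.1.fun_mul (hg.1.pderivAt i)),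
      ih (hf.pderivAt i) hg (by omega), ih hf (hg.pderivAt i) (by omega), add_zero]

theorem const_mul (hf : WeightedVanishing w n f) (c : ℝ) :
    WeightedVanishing w n (fun y => c * f y) :=
  ((of_analyticAt analyticAt_const).mul hf).mono (by omega)

theorem pow (hf : WeightedVanishing w m f) (k : ℕ) :
    WeightedVanishing w (k * m) (fun y => f y ^ k) := by
  induction k with
  | zero => simpa using of_analyticAt analyticAt_const
  | succ k ih => simpa only [pow_succ, Nat.succ_mul] using ih.mul hf

theorem sum {ι : Type*} (s : Finset ι) {F : ι → (Fin d → ℝ) → ℝ}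
    (h : ∀ i ∈ s, WeightedVanishing w n (F i)) :
    WeightedVanishing w n (fun y => ∑ i ∈ s, F i y) := by
  classical
  induction s using Finset.induction_on with
  | empty => simpa using zero
  | insert a s ha ih =>
    simp only [Finset.sum_insert ha]
    exact (h a (by simp)).add (ih fun i hi => h i (by simp [hi]))

theorem iterate_pderivAt (hf : WeightedVanishing w n f) (i : Fin d) (k : ℕ) :
    WeightedVanishing w (n - k * w i) ((_root_.pderivAt d i)^[k] f) := by
  induction k with
  | zero => simpa using hf
  | succ k ih =>
    rw [Function.iterate_succ_apply']
    exact (ih.pderivAt i).mono (by rw [Nat.succ_mul, Nat.sub_add_eq])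

theorem multiDeriv_apply_zero (hf : WeightedVanishing w n f) (γ : Fin d → ℕ)
    (hγ : ∑ i, γ i * w i < n) : multiDeriv d γ f 0 = 0 := by
  have key (L : List (Fin d)) : WeightedVanishing w (n - (L.map fun i => γ i * w i).sum)
      (L.foldr (fun i g => (_root_.pderivAt d i)^[γ i] g) f) := by
    induction L with
    | nil => simpa using hf
    | cons i L ih =>
      exact (ih.iterate_pderivAt i (γ i)).mono
        (by simp only [List.map_cons, List.sum_cons]; omega)
  refine (key (List.finRange d)).apply_zero ?_
  rw [← List.ofFn_eq_map, List.sum_ofFn]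
  omega

theorem comp_continuousLinearMap {h h' : ℝ → ℝ} (hw : ∀ i, m ≤ w i)
    (L : (Fin d → ℝ) →L[ℝ] ℝ) (hh : ∀ x, HasDerivAt h (h' x) x) (ha : AnalyticAt ℝ h 0)
    (h0 : h 0 = 0) (hv : WeightedVanishing w n (fun y => h' (L y))) :
    WeightedVanishing w (n + m) (fun y => h (L y)) := by
  refine of_pderivAt (AnalyticAt.fun_comp (by simpa using ha) (L.analyticAt 0)) (by simpa using h0)
    fun i => ?_
  have : _root_.pderivAt d i (fun y => h (L y)) = fun y => L (Pi.single i 1) * h' (L y) := by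
    funext y
    have := ((hh (L y)).comp_hasFDerivAt y L.hasFDerivAt).fderiv
    simp only [_root_.pderivAt]
    erw [this]
    simp [mul_comm]
  rw [this]
  exact (hv.const_mul _).mono (by have := hw i; omega)

theorem coord (i : Fin d) : WeightedVanishing w (w i) (fun y => y i) := by
  refine of_pderivAt ((ContinuousLinearMap.proj (R := ℝ) (φ := fun _ : Fin d => ℝ) i).analyticAt 0)
    rfl fun j => ?_
  have : _root_.pderivAt d j (fun y => y i) = fun _ => (Pi.single j 1 : Fin d → ℝ) i := by
    funext y
    simp only [_root_.pderivAt]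
    rw [(hasFDerivAt_apply i y).fderiv]
    rfl
  rw [this]
  by_cases hij : j = i
  · subst hij
    simpa using of_analyticAt analyticAt_const
  · rw [Pi.single_eq_of_ne (Ne.symm hij)]
    exact zero

theorem sin_sub_id (hw : ∀ i, 2 ≤ w i) (L : (Fin d → ℝ) →L[ℝ] ℝ) :
    WeightedVanishing w 6 (fun y => Real.sin (L y) - L y) := by
  have h₁ : WeightedVanishing w 2 (fun y => -Real.sin (L y)) :=
    comp_continuousLinearMap (n := 0) (h := fun x => -Real.sin x) hw L
      (fun x => (Real.hasDerivAt_sin x).neg) (by fun_prop) (by simp)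
      (of_analyticAt (AnalyticAt.fun_comp (g := fun x => -Real.cos x) (by fun_prop)
        (L.analyticAt 0)))
  have h₂ : WeightedVanishing w 4 (fun y => Real.cos (L y) - 1) :=
    comp_continuousLinearMap (h := fun x => Real.cos x - 1) hw L
      (fun x => (Real.hasDerivAt_cos x).sub_const 1) (by fun_prop) (by simp) h₁
  exact comp_continuousLinearMap (h := fun x => Real.sin x - x) hw L
    (fun x => (Real.hasDerivAt_sin x).sub (hasDerivAt_id x)) (by fun_prop) (by simp) h₂

theorem sin_sub_id_add_cube (hw : ∀ i, 2 ≤ w i) (L : (Fin d → ℝ) →L[ℝ] ℝ) :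
    WeightedVanishing w 10 (fun y => Real.sin (L y) - L y + L y ^ 3 / 6) := by
  have h₁ : WeightedVanishing w 8 (fun y => Real.cos (L y) - 1 + L y ^ 2 / 2) := by
    refine comp_continuousLinearMap (h := fun x => Real.cos x - 1 + x ^ 2 / 2)
      (h' := fun x => -1 * (Real.sin x - x)) hw L (fun x => ?_) (by fun_prop) (by simp)
      ((sin_sub_id hw L).const_mul (-1))
    refine (((Real.hasDerivAt_cos x).sub_const 1).add
      ((hasDerivAt_pow 2 x).div_const 2)).congr_deriv ?_
    push_cast
    ring
  refine comp_continuousLinearMap (h := fun x => Real.sin x - x + x ^ 3 / 6)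
    (h' := fun x => Real.cos x - 1 + x ^ 2 / 2) hw L (fun x => ?_) (by fun_prop) (by simp) h₁
  refine (((Real.hasDerivAt_sin x).sub (hasDerivAt_id x)).add
    ((hasDerivAt_pow 3 x).div_const 6)).congr_deriv ?_
  push_cast
  ring

end WeightedVanishing

end WeightedVanishing

/-- The linear change of variables `x_j = -b y_j` for `j ≠ i` and
`x_i = b ∑_{j ≠ i} y_j + a y_i`. -/
noncomputable def shearEquiv {d : ℕ} (i : Fin d) {a b : ℝ} (ha : a ≠ 0) (hb : b ≠ 0) :
    (Fin d → ℝ) ≃ₗ[ℝ] (Fin d → ℝ) where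
  toFun y j := if j = i then b * (∑ k ∈ Finset.univ.erase i, y k) + a * y i else -b * y j
  map_add' y z := by
    funext j
    simp only [Pi.add_apply, Finset.sum_add_distrib]
    split_ifs <;> ring
  map_smul' c y := by
    funext j
    simp only [Pi.smul_apply, smul_eq_mul, ← Finset.mul_sum, RingHom.id_apply]
    split_ifs <;> ring
  invFun x j := if j = i then (∑ k, x k) / a else -(x j / b)
  left_inv y := by
    funext j
    by_cases hj : j = i
    · subst hj
      simp only [if_true]
      rw [← Finset.add_sum_erase _ _ (Finset.mem_univ j),
        Finset.sum_congr rfl fun k hk => if_neg (Finset.ne_of_mem_erase hk), ← Finset.mul_sum,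
        if_pos rfl]
      field_simp
      ring
    · simp only [if_neg hj]
      field_simp
  right_inv x := by
    funext j
    by_cases hj : j = i
    · subst hj
      simp only [if_true]
      rw [← Finset.add_sum_erase _ x (Finset.mem_univ j),
        Finset.sum_congr rfl fun k hk => if_neg (Finset.ne_of_mem_erase hk),
        Finset.sum_neg_distrib, ← Finset.sum_div]
      field_simp
      ring
    · simp only [if_neg hj]
      field_simp

section shearEquiv

variable {d : ℕ} (i : Fin d) {a b : ℝ} (ha : a ≠ 0) (hb : b ≠ 0) (y : Fin d → ℝ)

theorem shearEquiv_apply_self :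
    shearEquiv i ha hb y i = b * (∑ k ∈ Finset.univ.erase i, y k) + a * y i :=
  if_pos rfl

theorem shearEquiv_apply_of_ne {j : Fin d} (hj : j ≠ i) : shearEquiv i ha hb y j = -b * y j :=
  if_neg hj

theorem sum_shearEquiv : ∑ j, shearEquiv i ha hb y j = a * y i := by
  rw [← Finset.add_sum_erase _ _ (Finset.mem_univ i), shearEquiv_apply_self,
    Finset.sum_congr rfl fun k hk =>
      shearEquiv_apply_of_ne i ha hb y (Finset.ne_of_mem_erase hk), ← Finset.mul_sum]
  ring

theorem sum_shearEquiv_pow_three : ∑ j, shearEquiv i ha hb y j ^ 3 =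
    (b * (∑ k ∈ Finset.univ.erase i, y k) + a * y i) ^ 3 -
      b ^ 3 * ∑ k ∈ Finset.univ.erase i, y k ^ 3 := by
  rw [← Finset.add_sum_erase _ _ (Finset.mem_univ i), shearEquiv_apply_self,
    Finset.sum_congr rfl fun k hk => congrArg (· ^ 3)
      (shearEquiv_apply_of_ne i ha hb y (Finset.ne_of_mem_erase hk))]
  simp only [mul_pow, ← Finset.mul_sum]
  ring

end shearEquiv

theorem discOmega_add_pi_div_two {d : ℕ} (hd : 0 < d) (x : Fin d → ℝ) :
    discOmega d (fun j => x j + Real.pi / 2) =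
      Real.sqrt (2 * d) * Real.sqrt (1 + (∑ j, Real.sin (x j)) / d) := by
  have hd' : (d : ℝ) ≠ 0 := by positivity
  rw [discOmega, ← Real.sqrt_mul (by positivity)]
  congr 1
  simp only [Real.cos_add_pi_div_two, Finset.sum_sub_distrib, ← Finset.mul_sum,
    Finset.sum_neg_distrib, Finset.sum_const, Finset.card_univ, Fintype.card_fin, nsmul_eq_mul]
  field_simp
  ring

theorem weightedVanishing_sqrt_one_add_sub_one {d n : ℕ} {w : Fin d → ℕ}
    {u : (Fin d → ℝ) → ℝ} (hu : WeightedVanishing w n u) (hn : 0 < n) :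
    WeightedVanishing w n (fun y => Real.sqrt (1 + u y) - 1) := by
  have hs : AnalyticAt ℝ (fun y => Real.sqrt (1 + u y)) 0 :=
    AnalyticAt.fun_comp (g := Real.sqrt) (Real.contDiffAt_sqrt (by simp [hu.apply_zero hn])).analyticAt
      (analyticAt_const.add hu.1)
  have hi : AnalyticAt ℝ (fun y => (Real.sqrt (1 + u y) + 1)⁻¹) 0 :=
    (hs.add analyticAt_const).inv
      (add_pos_of_nonneg_of_pos (Real.sqrt_nonneg _) one_pos).ne'
  have key := hu.mul (.of_analyticAt hi)
  have hpos : ∀ᶠ y in 𝓝 (0 : Fin d → ℝ), 0 < 1 + u y :=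
    (analyticAt_const.add hu.1).continuousAt.eventually (lt_mem_nhds (by simp [hu.apply_zero hn]))
  have he : (fun y => u y * (Real.sqrt (1 + u y) + 1)⁻¹) =ᶠ[𝓝 0]
      fun y => Real.sqrt (1 + u y) - 1 := by
    filter_upwards [hpos] with y hy
    have h₁ := Real.sq_sqrt hy.le
    rw [← div_eq_mul_inv, div_eq_iff (by positivity)]
    linear_combination -h₁
  exact key.congr he

/-- decomposition of the phase `φ(v,ξ) = v·ξ − ω(ξ)` at the most
degenerate point `ξ₀ = (π/2,…,π/2)` with velocity `v₀ = (1/√(2d),…,1/√(2d))`: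
`φ(v, Φ(y)+ξ₀) = c + v·ξ₀ + (v−v₀)·Φ(y) + y_d² + (∑_{j<d} y_j)³ − ∑_{j<d} y_j³ + R(y)`,
where `R` is real-analytic with all Taylor coefficients of multi-indices `γ` with
`γ·w_d ≤ 1` vanishing (`w_d = (1/3,…,1/3,1/2)`); the `γ`-th Taylor coefficient is
`∂^γ R(0)/γ!`, so this is expressed by the vanishing of `∂^γ R(0)`. -/
theorem phase_decomposition_most_degenerate (d : ℕ) (hd : 3 ≤ d) :
    ∃ (Φ : (Fin d → ℝ) ≃ₗ[ℝ] (Fin d → ℝ)) (c ρ : ℝ) (R : (Fin d → ℝ) → ℝ),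
      0 < ρ ∧ AnalyticAt ℝ R 0 ∧ R 0 = 0 ∧
      (∀ γ : Fin d → ℕ,
        (∑ j : Fin d, (γ j : ℝ) *
            (if (j : ℕ) = d - 1 then (1 : ℝ) / 2 else 1 / 3)) ≤ 1 →
        multiDeriv d γ R 0 = 0) ∧
      ∀ (v : Fin d → ℝ) (y : Fin d → ℝ), y ∈ Metric.ball (0 : Fin d → ℝ) ρ →
        (∑ j, v j * (Φ y j + Real.pi / 2)) -
            discOmega d (fun j => Φ y j + Real.pi / 2)
          = c + (∑ j, v j * (Real.pi / 2)) +
            (∑ j, (v j - 1 / Real.sqrt (2 * d)) * Φ y j) +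
            y ⟨d - 1, by omega⟩ ^ 2 +
            (∑ j ∈ Finset.univ.filter fun j : Fin d => (j : ℕ) < d - 1, y j) ^ 3 -
            (∑ j ∈ Finset.univ.filter fun j : Fin d => (j : ℕ) < d - 1, y j ^ 3) +
            R y := by
  set i₀ : Fin d := ⟨d - 1, by omega⟩ with hi₀
  set T : ℝ := Real.sqrt (2 * d)
  have hd₀ : (0 : ℝ) < d := by exact_mod_cast (by omega : 0 < d)
  have hTpos : 0 < T := by positivity
  have hTsq : T ^ 2 = 2 * d := Real.sq_sqrt (by positivity)
  obtain ⟨a, ha, hasq⟩ : ∃ a : ℝ, a ≠ 0 ∧ a ^ 2 = 2 * T ^ 3 :=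
    ⟨Real.sqrt (2 * T ^ 3), by positivity, Real.sq_sqrt (by positivity)⟩
  obtain ⟨b, hb, hbcube⟩ : ∃ b : ℝ, b ≠ 0 ∧ b ^ 3 = 6 * T :=
    ⟨(6 * T) ^ ((3 : ℕ) : ℝ)⁻¹, by positivity,
      Real.rpow_inv_natCast_pow (by positivity) (by norm_num)⟩
  have hfilter : (Finset.univ.filter fun j : Fin d => (j : ℕ) < d - 1) = Finset.univ.erase i₀ := by
    ext j
    have := j.isLt
    simp only [Finset.mem_filter, Finset.mem_univ, true_and, Finset.mem_erase, and_true, ne_eq,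
      hi₀, Fin.ext_iff]
    omega
  rw [hfilter]
  set Φ := shearEquiv i₀ ha hb
  set σ : (Fin d → ℝ) → ℝ := fun y => ∑ k ∈ Finset.univ.erase i₀, y k with hσ
  set S : (Fin d → ℝ) → ℝ := fun y => ∑ j, Real.sin (Φ y j) with hS
  set t : (Fin d → ℝ) → ℝ := fun y => Real.sqrt (1 + S y / d) - 1 with ht
  set w : Fin d → ℕ := fun j => if (j : ℕ) = d - 1 then 3 else 2 with hw
  set R : (Fin d → ℝ) → ℝ := fun y => -T * t y + a * y i₀ / T - y i₀ ^ 2 - σ y ^ 3 +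
    ∑ k ∈ Finset.univ.erase i₀, y k ^ 3 with hR
  have hw₂ : ∀ j, 2 ≤ w j := fun j => by
    simp only [hw]
    split_ifs <;> omega
  let L : Fin d → (Fin d → ℝ) →L[ℝ] ℝ := fun j =>
    (ContinuousLinearMap.proj (R := ℝ) (φ := fun _ : Fin d => ℝ) j).comp
      (LinearMap.toContinuousLinearMap (Φ : (Fin d → ℝ) →ₗ[ℝ] (Fin d → ℝ)))
  have hy₀ : WeightedVanishing w 3 (fun y => y i₀) := by
    simpa [hw, hi₀] using WeightedVanishing.coord (w := w) i₀
  have hσv : WeightedVanishing w 2 σ :=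
    .sum _ fun k _ => (WeightedVanishing.coord k).mono (hw₂ k)
  have hSs : WeightedVanishing w 6 (fun y => S y - a * y i₀) := by
    have h := WeightedVanishing.sum Finset.univ fun j _ => WeightedVanishing.sin_sub_id hw₂ (L j)
    refine h.congr (.of_forall fun y => ?_)
    change _ = S y - a * y i₀
    rw [← sum_shearEquiv i₀ ha hb, ← Finset.sum_sub_distrib]
    rfl
  have hSe : WeightedVanishing w 7
      (fun y => S y - a * y i₀ + (∑ j, Φ y j ^ 3) / 6) := by
    have h := WeightedVanishing.sum Finset.univ fun j _ =>
      WeightedVanishing.sin_sub_id_add_cube hw₂ (L j)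
    refine (h.mono (by norm_num)).congr (.of_forall fun y => ?_)
    change _ = S y - a * y i₀ + _
    rw [← sum_shearEquiv i₀ ha hb]
    rw [← Finset.sum_sub_distrib, Finset.sum_div,
      ← Finset.sum_add_distrib]
    rfl
  have hSv : WeightedVanishing w 3 S :=
    ((hSs.mono (by norm_num)).add (hy₀.const_mul a)).congr (.of_forall fun y => by ring)
  have htv : WeightedVanishing w 3 t :=
    weightedVanishing_sqrt_one_add_sub_one
      ((hSv.const_mul (d : ℝ)⁻¹).congr (.of_forall fun y => by ring)) (by norm_num)
  have hcross : WeightedVanishing w 7 (fun y => y i₀ *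
      (3 * b ^ 2 * a * σ y ^ 2 + (3 * b * a ^ 2 * (σ y * y i₀) + a ^ 3 * y i₀ ^ 2))) :=
    hy₀.mul (((hσv.pow 2).const_mul _).add
      ((((hσv.mul hy₀).mono (by norm_num)).const_mul _).add
        (((hy₀.pow 2).mono (by norm_num)).const_mul _)))
  have hquad : WeightedVanishing w 7 (fun y => (S y - a * y i₀) * (S y + a * y i₀)) :=
    (hSs.mul (hSv.add (hy₀.const_mul a))).mono (by norm_num)
  have htail : WeightedVanishing w 7 (fun y => t y ^ 3 * (t y + 4)) :=
    ((htv.pow 3).mul (.of_analyticAt (htv.1.add analyticAt_const))).mono (by norm_num)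
  have hRv : WeightedVanishing w 7 R := by
    refine ((hcross.const_mul (1 / (6 * T))).add ((hSe.const_mul (-1 / T)).add
      ((hquad.const_mul (1 / (2 * T ^ 3))).add (htail.const_mul (-T / 8))))).congr ?_
    have hpos : ∀ᶠ y in 𝓝 (0 : Fin d → ℝ), 0 < 1 + S y / d :=
      (analyticAt_const.add hSv.1.div_const).continuousAt.eventually
        (lt_mem_nhds (by simp [hSv.apply_zero]))
    filter_upwards [hpos] with y hy
    have hsq : (t y + 1) ^ 2 = 1 + S y / d := by
      simpa [ht] using Real.sq_sqrt hy.le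
    have hSt : S y = (t y ^ 2 + 2 * t y) * T ^ 2 / 2 := by
      rw [hTsq]
      field_simp at hsq
      linear_combination -hsq
    rw [sum_shearEquiv_pow_three]
    simp only [hR]
    change _ * (y i₀ * _) + (_ * (_ + ((b * σ y + a * y i₀) ^ 3 - _) / 6) + _) = _
    have h₁ : b ^ 3 / (6 * T) = 1 := by
      rw [hbcube]
      field_simp
    have h₂ : a ^ 2 / (2 * T ^ 3) = 1 := by
      rw [hasq]
      field_simp
    have h₃ : S y / T = (t y ^ 2 + 2 * t y) * T / 2 := by
      rw [hSt]
      field_simp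
    have h₄ : S y ^ 2 / (2 * T ^ 3) = (t y ^ 2 + 2 * t y) ^ 2 * T / 8 := by
      rw [hSt]
      field_simp
      ring
    linear_combination (∑ k ∈ Finset.univ.erase i₀, y k ^ 3 - σ y ^ 3) * h₁ - y i₀ ^ 2 * h₂ -
      h₃ + h₄
  refine ⟨Φ, -T, 1, R, one_pos, hRv.1, hRv.apply_zero (by norm_num), fun γ hγ => ?_,
    fun v y _ => ?_⟩
  · refine hRv.multiDeriv_apply_zero γ ?_
    have h : ((∑ j, γ j * w j : ℕ) : ℝ) ≤ 6 := by
      push_cast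
      calc ∑ j, (γ j : ℝ) * (w j : ℝ)
          = 6 * ∑ j : Fin d, (γ j : ℝ) * (if (j : ℕ) = d - 1 then (1 : ℝ) / 2 else 1 / 3) := by
            rw [Finset.mul_sum]
            refine Finset.sum_congr rfl fun j _ => ?_
            simp only [hw]
            split_ifs <;> push_cast <;> ring
        _ ≤ 6 := by linarith
    have : ∑ j, γ j * w j ≤ 6 := by exact_mod_cast h
    omega
  · have hs := sum_shearEquiv i₀ ha hb y
    rw [discOmega_add_pi_div_two (by omega)]
    simp only [mul_add, sub_mul, Finset.sum_add_distrib, Finset.sum_sub_distrib, ← Finset.mul_sum]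
    rw [hs]
    simp only [hR, ht, hσ, hS]
    ring
end

section
/- Let d ≥ 2, let b > d/(d−1) and let 1 ≤ a ≤ bd/(b+d). Define the kernel K : ℤ^d → ℂ by K(x) = (2π)^{-d} ∫_{[−π,π]^d} e^{i x·ξ} ω(ξ)^{-1} dξ. Then there exists a constant C > 0 such that for every f ∈ l^a(ℤ^d) the convolution (K*f)(x) = ∑_{y∈ℤ^d} K(x−y) f(y) satisfies ‖K*f‖_{l^b(ℤ^d)} ≤ C ‖f‖_{l^a(ℤ^d)}. -/
open MeasureTheory Complex ENNReal

/-- the cube `[-π,π]^d` -/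
def torusBox (d : ℕ) : Set (Fin d → ℝ) :=
  Set.univ.pi fun _ => Set.Icc (-Real.pi) Real.pi

/-- the kernel of the operator `(-Δ)^{-1/2}` on `ℤ^d`. -/
noncomputable def invSqrtLapKernel (d : ℕ) (x : Fin d → ℤ) : ℂ :=
  ((2 * Real.pi : ℂ) ^ d)⁻¹ *
    ∫ ξ in torusBox d,
      Complex.exp (Complex.I * ((∑ j, (x j : ℝ) * ξ j : ℝ) : ℂ)) *
        ((discOmega d ξ : ℝ) : ℂ)⁻¹

/-- the `l^p` norm on `ℤ^d` (with respect to counting measure). -/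
noncomputable def lpNorm (d : ℕ) (p : ℝ≥0∞) (f : (Fin d → ℤ) → ℂ) : ℝ≥0∞ :=
  eLpNorm f p Measure.count

theorem choose_half_nonneg_and_sq_mul_le : ∀ n : ℕ, 0 ≤ Ring.choose ((1/2:ℝ) + n - 1) n ∧
    Ring.choose ((1/2:ℝ) + n - 1) n ^ 2 * (2 * n + 1) ≤ 1 := by
  have key : ∀ n : ℕ, Ring.choose ((1/2:ℝ) + n - 1) n = Ring.multichoose (1/2:ℝ) n := by
    intro n
    rw [Ring.choose]; congr 1; ring
  have hrec : ∀ n : ℕ, Ring.multichoose (1/2:ℝ) (n+1) * (n+1) = Ring.multichoose (1/2:ℝ) n * (1/2 + n) := by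
    intro n
    have h1 := Ring.factorial_nsmul_multichoose_eq_ascPochhammer (1/2:ℝ) (n+1)
    have h2 := Ring.factorial_nsmul_multichoose_eq_ascPochhammer (1/2:ℝ) n
    rw [Polynomial.ascPochhammer_smeval_eq_eval] at h1 h2
    rw [ascPochhammer_succ_eval, ← h2] at h1
    simp only [nsmul_eq_mul, Nat.factorial_succ] at h1
    push_cast at h1
    have : (n.factorial : ℝ) ≠ 0 := by positivity
    apply mul_left_cancel₀ this
    linarith
  intro n
  rw [key]
  induction n with
  | zero => simp
  | succ n ih =>
    obtain ⟨h0, h1⟩ := ih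
    have hr := hrec n
    set x := Ring.multichoose (1/2:ℝ) n
    set y := Ring.multichoose (1/2:ℝ) (n+1)
    have hn : (0:ℝ) ≤ n := by positivity
    have hy : y = x * (1/2+n) / (n+1) := by field_simp; linarith
    constructor
    · rw [hy]; positivity
    · rw [hy]
      push_cast
      rw [div_pow, div_mul_eq_mul_div, div_le_one (by positivity)]
      nlinarith [mul_le_mul_of_nonneg_right h1 (by positivity : 0 ≤ (1/2+(n:ℝ)) * (n + 3/2))]

theorem choose_half_le_rpow (n : ℕ) : Ring.choose ((1/2:ℝ) + n - 1) n ≤ ((n:ℝ)+1) ^ (-(1/2):ℝ) := by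
  obtain ⟨h0, h1⟩ := choose_half_nonneg_and_sq_mul_le n
  rw [Real.rpow_neg (by positivity), ← Real.sqrt_eq_rpow, ← Real.sqrt_inv]
  apply Real.le_sqrt_of_sq_le
  rw [← one_div, le_div_iff₀ (by positivity)]
  nlinarith [sq_nonneg (Ring.choose ((1/2:ℝ) + n - 1) n), (by positivity : (0:ℝ) ≤ n)]

/-- The binomial series of `(1 - z)^{-1/2}`. -/
theorem hasSum_inv_sqrt_one_sub {z : ℝ} (hz : |z| < 1) :
    HasSum (fun n : ℕ => Ring.choose ((1/2:ℝ) + n - 1) n * z ^ n) (Real.sqrt (1 - z))⁻¹ := by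
  have h := (Real.one_div_one_sub_rpow_hasFPowerSeriesOnBall_zero (1/2)).hasSum (y := z) (by
    rw [← ENNReal.ofReal_one, Metric.eball_ofReal]; simpa using hz)
  simpa [Real.sqrt_eq_rpow, FormalMultilinearSeries.ofScalars, one_div] using h

theorem sum_rpow_neg_half_le (M : ℕ) : ∑ m ∈ Finset.range M, ((m:ℝ)+1) ^ (-(1/2):ℝ) ≤ 2 * Real.sqrt M := by
  induction M with
  | zero => simp
  | succ M ih =>
    rw [Finset.sum_range_succ]
    have : ((M:ℝ)+1) ^ (-(1/2):ℝ) ≤ 2 * (Real.sqrt (M+1) - Real.sqrt M) := by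
      rw [Real.rpow_neg (by positivity), ← Real.sqrt_eq_rpow, inv_le_iff_one_le_mul₀ (by positivity)]
      have h1 := Real.sq_sqrt (by positivity : (0:ℝ) ≤ M+1)
      have h2 := Real.sq_sqrt (by positivity : (0:ℝ) ≤ M)
      nlinarith [sq_nonneg (Real.sqrt (M+1) - Real.sqrt M)]
    push_cast
    linarith

theorem rpow_neg_le_sub_rpow {s : ℝ} (hs : 1 < s) (m : ℕ) :
    ((m:ℝ)+1) ^ (-s) ≤ 2 ^ s / (s-1) * (((m:ℝ)+1) ^ (1-s) - ((m:ℝ)+2) ^ (1-s)) := by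
  have hs1 : 0 < s - 1 := by linarith
  have hm : (0:ℝ) < (m:ℝ) + 2 := by positivity
  have hm1 : (0:ℝ) < (m:ℝ) + 1 := by positivity
  have hb : 1 + (1-s) * (-(1/((m:ℝ)+2))) ≤ (1 + -(1/((m:ℝ)+2))) ^ (1-s) := by
    have hu : 0 < 1 + -(1/((m:ℝ)+2)) := by
      rw [lt_add_neg_iff_add_lt, zero_add, div_lt_one hm]; linarith
    rw [Real.rpow_def_of_pos hu]
    nlinarith [Real.add_one_le_exp (Real.log (1 + -(1/((m:ℝ)+2))) * (1-s)),
      Real.log_le_sub_one_of_pos hu]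
  have he : 1 + -(1/((m:ℝ)+2)) = (m+1)/(m+2) := by field_simp; ring
  rw [he, Real.div_rpow hm1.le hm.le, le_div_iff₀ (by positivity)] at hb
  have h3 : ((m:ℝ)+2) ^ (1-s) = ((m:ℝ)+2) ^ (-s) * (m+2) := by
    rw [← Real.rpow_add_one hm.ne']; ring_nf
  have h4 : ((m:ℝ)+1) ^ (-s) ≤ 2^s * ((m:ℝ)+2) ^ (-s) := by
    rw [Real.rpow_neg hm.le, Real.rpow_neg hm1.le, ← div_eq_mul_inv, ← one_div, div_le_div_iff₀ (by positivity) (by positivity), one_mul, ← Real.mul_rpow (by norm_num) hm1.le]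
    apply Real.rpow_le_rpow hm.le _ (by linarith)
    linarith
  have h5 : (s-1) * ((m:ℝ)+2) ^ (-s) ≤ ((m:ℝ)+1) ^ (1-s) - ((m:ℝ)+2) ^ (1-s) := by
    have : (1 + (1 - s) * -(1 / ((m:ℝ) + 2))) * ((m:ℝ) + 2) ^ (1 - s) = ((m:ℝ)+2)^(1-s) + (s-1) * ((m:ℝ)+2) ^ (-s) := by
      rw [h3]; field_simp; ring
    linarith
  calc _ ≤ _ := h4
    _ = 2^s/(s-1) * ((s-1) * ((m:ℝ)+2) ^ (-s)) := by field_simp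
    _ ≤ _ := by gcongr

theorem tsum_rpow_neg_tail_le {s : ℝ} (hs : 1 < s) (M : ℕ) :
    ∑' m : ℕ, ENNReal.ofReal (((m+M : ℕ):ℝ)+1) ^ (-s) ≤
      ENNReal.ofReal (2 ^ s / (s-1)  * ((M:ℝ)+1) ^ (1-s)) := by
  have hs1 : 0 < s - 1 := by linarith
  apply ENNReal.tsum_le_of_sum_range_le
  intro n
  have h : ∀ m : ℕ, ENNReal.ofReal (((m+M : ℕ):ℝ)+1) ^ (-s) = ENNReal.ofReal ((((m+M : ℕ):ℝ)+1) ^ (-s)) := by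
    intro m; rw [ENNReal.ofReal_rpow_of_pos (by positivity)]
  simp_rw [h]
  rw [← ENNReal.ofReal_sum_of_nonneg (by intro i _; positivity)]
  apply ENNReal.ofReal_le_ofReal
  calc _ ≤ ∑ m ∈ Finset.range n, (2 ^ s / (s-1) * (((m+M:ℕ):ℝ)+1) ^ (1-s) -
          2 ^ s / (s-1) * (((m+1+M:ℕ):ℝ)+1) ^ (1-s)) := ?_
    _ ≤ _ := ?_
  · apply Finset.sum_le_sum
    intro m _
    have := rpow_neg_le_sub_rpow hs (m+M)
    rw [mul_sub] at this
    rwa [show ((m + 1 + M : ℕ) : ℝ) + 1 = ((m + M : ℕ) : ℝ) + 2 by push_cast; ring]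
  · have := Finset.sum_range_sub' (fun m : ℕ => 2 ^ s / (s-1) * (((m+M:ℕ):ℝ)+1) ^ (1-s)) n
    rw [this]
    simp only [zero_add]
    have : 0 ≤ 2 ^ s / (s-1) * (((n+M:ℕ):ℝ)+1) ^ (1-s) := by positivity
    linarith

/-- Layer cake formula for powers of an extended nonnegative real. -/
theorem lintegral_rpow_mul_ite_lt {r : ℝ} (hr : 0 < r) (v : ℝ≥0∞) :
    ∫⁻ t in Set.Ioi (0:ℝ), ENNReal.ofReal (t ^ (r-1)) * (if ENNReal.ofReal t < v then 1 else 0) =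
      v ^ r / ENNReal.ofReal r := by
  have fin : ∀ u : ℝ, 0 ≤ u → ∫⁻ t in Set.Ioi (0:ℝ), ENNReal.ofReal (t ^ (r-1)) *
      (if ENNReal.ofReal t < ENNReal.ofReal u then 1 else 0) = ENNReal.ofReal u ^ r / ENNReal.ofReal r := by
    intro u hu
    have h1 : ∫⁻ t in Set.Ioi (0:ℝ), ENNReal.ofReal (t ^ (r-1)) *
      (if ENNReal.ofReal t < ENNReal.ofReal u then 1 else 0) = ∫⁻ t in Set.Ioo 0 u, ENNReal.ofReal (t ^ (r-1)) := by
      rw [← lintegral_indicator measurableSet_Ioi, ← lintegral_indicator measurableSet_Ioo]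
      congr 1; ext t
      by_cases ht : 0 < t
      · by_cases htu : t < u
        · simp [Set.indicator, ht, htu, ENNReal.ofReal_lt_ofReal_iff (ht.trans htu)]
        · have : ¬ ENNReal.ofReal t < ENNReal.ofReal u := by
            rw [not_lt]; exact ENNReal.ofReal_le_ofReal (not_lt.1 htu)
          simp [Set.indicator, ht, htu, this]
      · simp [Set.indicator, ht]
    rw [h1, setLIntegral_congr Ioo_ae_eq_Ioc, ← ofReal_integral_eq_lintegral_ofReal,
      ← intervalIntegral.integral_of_le hu, integral_rpow (Or.inl (by linarith)),
      sub_add_cancel, Real.zero_rpow hr.ne', sub_zero, ENNReal.ofReal_div_of_pos hr,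
      ENNReal.ofReal_rpow_of_nonneg hu hr.le]
    · rw [← IntegrableOn, ← intervalIntegrable_iff_integrableOn_Ioc_of_le hu]
      exact intervalIntegral.intervalIntegrable_rpow' (by linarith)
    · filter_upwards [ae_restrict_mem measurableSet_Ioc] with t ht
      exact Real.rpow_nonneg ht.1.le _
  induction v with
  | coe v => simpa using fin v v.2
  | top =>
    rw [ENNReal.top_rpow_of_pos hr, ENNReal.top_div_of_ne_top ofReal_ne_top]
    apply ENNReal.eq_top_of_forall_nnreal_le
    intro q
    have hle := fin (((q * r.toNNReal) ^ (1/r) : NNReal) : ℝ) (NNReal.coe_nonneg _)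
    rw [ENNReal.ofReal_coe_nnreal, ENNReal.coe_rpow_of_nonneg _ (by positivity), ← ENNReal.rpow_mul, one_div, inv_mul_cancel₀ hr.ne', ENNReal.rpow_one, ENNReal.coe_mul, ENNReal.ofReal,
      ENNReal.mul_div_cancel_right (by simpa using hr) coe_ne_top] at hle
    rw [← hle]
    refine lintegral_mono fun t => mul_le_mul_right ?_ _
    split_ifs with h1 h2
    · rfl
    · exact absurd ofReal_lt_top h2
    · exact zero_le_one
    · rfl

section WeightedConvolution
variable {ι : Type*} [AddCommGroup ι]

/-- Convolution with a sub-probability bounded by `B` maps the `l^a` unit ball into the ball of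
radius `B^{1/a}` of `l^∞`. -/
theorem tsum_convolution_le_rpow_inv {p F : ι → ℝ≥0∞} {a : ℝ} {B : ℝ≥0∞} (ha : 1 ≤ a) (hp : ∑' x, p x ≤ 1) (hB : ∀ x, p x ≤ B)
    (hF : ∑' y, F y ^ a ≤ 1) (x : ι) : ∑' y, p (x - y) * F y ≤ B ^ a⁻¹ := by
  have ha0 : 0 < a := by linarith
  have h1a : 0 ≤ 1 - a⁻¹ := by
    have := inv_le_one_of_one_le₀ ha
    linarith
  apply ENNReal.summable.tsum_le_of_sum_le
  intro s
  refine (ENNReal.inner_le_weight_mul_Lp_of_nonneg s ha _ _).trans ?_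
  have h1 : ∑ y ∈ s, p (x - y) ≤ 1 := by
    refine (ENNReal.sum_le_tsum s).trans ?_
    exact ((Equiv.subLeft x).tsum_eq p).trans_le hp
  have h2 : ∑ y ∈ s, p (x - y) * F y ^ a ≤ B := by
    calc _ ≤ ∑ y ∈ s, B * F y ^ a := Finset.sum_le_sum fun y _ => by gcongr; exact hB _
      _ = B * ∑ y ∈ s, F y ^ a := by rw [Finset.mul_sum]
      _ ≤ B * 1 := by gcongr; exact (ENNReal.sum_le_tsum s).trans hF
      _ = B := mul_one _
  calc _ ≤ (1:ℝ≥0∞) ^ (1 - a⁻¹) * B ^ a⁻¹ := by gcongr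
    _ = _ := by simp

/-- The weights `(m+1)^{-1/2}`. -/
noncomputable def wt (m : ℕ) : ℝ≥0∞ := ENNReal.ofReal ((m:ℝ)+1) ^ (-(1/2):ℝ)

theorem sum_wt_le (M : ℕ) : ∑ m ∈ Finset.range M, wt m ≤ ENNReal.ofReal (2 * √M) := by
  have h : ∀ m : ℕ, wt m = ENNReal.ofReal (((m:ℝ)+1) ^ (-(1/2):ℝ)) := fun m => by
    rw [wt, ENNReal.ofReal_rpow_of_pos (by positivity)]
  simp_rw [h]
  rw [← ENNReal.ofReal_sum_of_nonneg (by intro i _; positivity)]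
  exact ENNReal.ofReal_le_ofReal (sum_rpow_neg_half_le M)

variable {p : ℕ → ι → ℝ≥0∞}

theorem sum_convolution_le_of_le (hp : ∀ m, ∑' x, p m x ≤ 1) {G : ι → ℝ≥0∞} {c : ℝ≥0∞} (hG : ∀ y, G y ≤ c) (M : ℕ) (x : ι) :
    ∑ m ∈ Finset.range M, wt m * ∑' y, p m (x - y) * G y ≤ ENNReal.ofReal (2 * √M) * c := by
  calc _ ≤ ∑ m ∈ Finset.range M, wt m * c := by
        gcongr with m _
        calc _ ≤ ∑' y, p m (x - y) * c := by gcongr; exact hG _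
          _ = (∑' y, p m y) * c := by rw [ENNReal.tsum_mul_right]; congr 1; exact (Equiv.subLeft x).tsum_eq (p m)
          _ ≤ 1 * c := by gcongr; exact hp m
          _ = c := one_mul c
    _ ≤ _ := by rw [← Finset.sum_mul]; gcongr; exact sum_wt_le M

theorem tsum_sum_convolution_le (hp : ∀ m, ∑' x, p m x ≤ 1) (G : ι → ℝ≥0∞) (M : ℕ) :
    ∑' x, ∑ m ∈ Finset.range M, wt m * ∑' y, p m (x - y) * G y ≤ ENNReal.ofReal (2 * √M) * ∑' y, G y := by
  rw [Summable.tsum_finsetSum (fun _ _ => ENNReal.summable)]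
  calc _ ≤ ∑ m ∈ Finset.range M, wt m * ∑' y, G y := by
        gcongr with m _
        rw [ENNReal.tsum_mul_left, ENNReal.tsum_comm]
        gcongr with y
        rw [ENNReal.tsum_mul_right]
        calc _ ≤ 1 * G y := by gcongr; exact ((Equiv.subRight y).tsum_eq (p m)).trans_le (hp m)
          _ = _ := one_mul _
    _ ≤ _ := by rw [← Finset.sum_mul]; gcongr; exact sum_wt_le M

theorem tsum_convolution_tail_le (hp : ∀ m, ∑' x, p m x ≤ 1) {B D a : ℝ} (hB : 0 < B) (ha : 1 ≤ a) (haD : a < D)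
    (hpB : ∀ m x, p m x ≤ ENNReal.ofReal B * ENNReal.ofReal ((m:ℝ)+1) ^ (-(D/2)))
    {F : ι → ℝ≥0∞} (hF : ∑' y, F y ^ a ≤ 1) (M : ℕ) (x : ι) :
    ∑' m, wt (m + M) * ∑' y, p (m + M) (x - y) * F y ≤
      ENNReal.ofReal (B ^ a⁻¹ * (2 ^ (1/2 + D/(2*a)) / (1/2 + D/(2*a) - 1)) * ((M:ℝ)+1) ^ (1 - (1/2 + D/(2*a)))) := by
  have ha0 : 0 < a := by linarith
  have hs : 1 < 1/2 + D/(2*a) := by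
    have : 1/2 < D/(2*a) := by rw [div_lt_div_iff₀ (by norm_num) (by positivity)]; linarith
    linarith
  calc _ ≤ ∑' m : ℕ, ENNReal.ofReal (B ^ a⁻¹) * ENNReal.ofReal (((m+M : ℕ):ℝ)+1) ^ (-(1/2 + D/(2*a))) := by
        refine ENNReal.tsum_le_tsum fun m => ?_
        have hpos : 0 < ENNReal.ofReal (((m+M:ℕ):ℝ)+1) := by rw [ENNReal.ofReal_pos]; positivity
        calc _ ≤ wt (m + M) * (ENNReal.ofReal B * ENNReal.ofReal (((m+M:ℕ):ℝ)+1) ^ (-(D/2))) ^ a⁻¹ := by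
              refine mul_le_mul_right ?_ _; exact tsum_convolution_le_rpow_inv ha (hp _) (hpB _) hF x
          _ = _ := by
            rw [wt, ENNReal.mul_rpow_of_nonneg _ _ (by positivity), ← ENNReal.rpow_mul,
              ENNReal.ofReal_rpow_of_pos hB, mul_left_comm, ← ENNReal.rpow_add _ _ hpos.ne' ofReal_ne_top]
            congr 2
            field_simp
            ring
    _ ≤ _ := by
      rw [ENNReal.tsum_mul_left, mul_assoc, ENNReal.ofReal_mul (by positivity)]
      gcongr
      exact tsum_rpow_neg_tail_le hs M

theorem ENNReal.tsum_eq_sum_range_add_tsum_nat_add (f : ℕ → ℝ≥0∞) (k : ℕ) :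
    ∑' m, f m = ∑ m ∈ Finset.range k, f m + ∑' m, f (m + k) := by
  have h : Summable fun m => f (m + k) := ENNReal.summable
  exact h.sum_add_tsum_nat_add'.symm

theorem tsum_convolution_eq_head_add_tail (M : ℕ) {F F1 F2 : ι → ℝ≥0∞} (h : ∀ y, F y = F1 y + F2 y) (x : ι) :
    ∑' m, wt m * ∑' y, p m (x - y) * F y =
      ∑ m ∈ Finset.range M, wt m * ∑' y, p m (x - y) * F1 y +
        (∑ m ∈ Finset.range M, wt m * ∑' y, p m (x - y) * F2 y +
          ∑' m, wt (m + M) * ∑' y, p (m + M) (x - y) * F y) := by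
  have hm : ∀ m, wt m * ∑' y, p m (x - y) * F y =
      wt m * ∑' y, p m (x - y) * F1 y + wt m * ∑' y, p m (x - y) * F2 y := by
    intro m
    rw [← mul_add, ← ENNReal.tsum_add]
    simp_rw [← mul_add, ← h]
  rw [ENNReal.tsum_eq_sum_range_add_tsum_nat_add _ M, Finset.sum_congr rfl fun m _ => hm m,
    Finset.sum_add_distrib, add_assoc]

set_option maxHeartbeats 1000000 in
/-- Distributional estimate for `∑ wt m * (p m * F)`, with only the part of `F` above the level
`t^{b/a}` on the right-hand side. -/
theorem exists_weak_type_bound (hp : ∀ m, ∑' x, p m x ≤ 1) {B D a b : ℝ} (hB : 0 < B) (ha : 1 ≤ a) (haD : a < D) (hb : 0 < b)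
    (hab : 1 / a = 1 / b + 1 / D)
    (hpB : ∀ m x, p m x ≤ ENNReal.ofReal B * ENNReal.ofReal ((m:ℝ)+1) ^ (-(D/2))) :
    ∃ E : ℝ, 0 < E ∧ ∀ F : ι → ℝ≥0∞, ∑' y, F y ^ a ≤ 1 → ∀ t : ℝ, 0 < t →
      ∑' x, (if ENNReal.ofReal t < ∑' m, wt m * ∑' y, p m (x - y) * F y then 1 else 0 : ℝ≥0∞) ≤
        ENNReal.ofReal (E * t ^ (-(b / a))) * ∑' y, if ENNReal.ofReal (t ^ (b / a)) < ENNReal.ofReal (2 * E) * F y then F y else 0 := by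
  have ha0 : 0 < a := by linarith
  have hD0 : 0 < D := by linarith
  have hs : 1 - (1/2 + D/(2*a)) = - (D / (2 * b)) := by
    have : D / (2*a) = D / 2 * (1 / a) := by field_simp
    rw [this, hab]; field_simp; ring
  have hs1 : 0 < 1/2 + D/(2*a) - 1 := by
    have : 0 < D / (2 * b) := by positivity
    linarith
  have hba : b / a = 1 + b / D := by
    have : b / a = b * (1 / a) := by ring
    rw [this, hab]; field_simp
  set C := B ^ a⁻¹ * (2 ^ (1/2 + D/(2*a)) / (1/2 + D/(2*a) - 1)) with hC
  have hC0 : 0 < C := by positivity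
  refine ⟨4 * (4 * C) ^ (b / D), by positivity, ?_⟩
  intro F hF t ht
  set N : ℝ := (t / (4 * C)) ^ (-(2 * b / D)) with hN
  have hN0 : 0 < N := by positivity
  set M := ⌊N⌋₊
  set Q := (t / (4 * C)) ^ (-(b / D)) with hQ
  have hQ0 : 0 < Q := by positivity
  have hMQ : √M ≤ Q := by
    have : Q = √N := by
      rw [Real.sqrt_eq_rpow, hN, ← Real.rpow_mul (by positivity), hQ]; congr 1; ring
    rw [this]
    exact Real.sqrt_le_sqrt (Nat.floor_le hN0.le)
  have htail : ∀ x, ∑' m, wt (m + M) * ∑' y, p (m + M) (x - y) * F y ≤ ENNReal.ofReal (t / 4) := by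
    intro x
    refine (tsum_convolution_tail_le hp hB ha haD hpB hF M x).trans (ENNReal.ofReal_le_ofReal ?_)
    rw [← hC, hs]
    calc C * ((M:ℝ)+1) ^ (-(D/(2*b))) ≤ C * N ^ (-(D/(2*b))) := by
          gcongr 1
          exact Real.rpow_le_rpow_of_nonpos hN0 (Nat.lt_floor_add_one N).le (by rw [neg_nonpos]; positivity)
      _ = t / 4 := by
        rw [hN, ← Real.rpow_mul (by positivity)]
        have : -(2 * b / D) * -(D / (2 * b)) = 1 := by field_simp
        rw [this, Real.rpow_one]; field_simp
  set γ := t / (8 * Q) with hγ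
  set F1 : ι → ℝ≥0∞ := fun y => if ENNReal.ofReal γ < F y then F y else 0 with hF1
  set F2 : ι → ℝ≥0∞ := fun y => if ENNReal.ofReal γ < F y then 0 else F y with hF2
  have hF12 : ∀ y, F y = F1 y + F2 y := by
    intro y; simp only [hF1, hF2]; split_ifs <;> simp
  have hF2le : ∀ y, F2 y ≤ ENNReal.ofReal γ := by
    intro y; simp only [hF2]; split_ifs with h
    · simp
    · exact not_lt.1 h
  have hhead2 : ∀ x, ∑ m ∈ Finset.range M, wt m * ∑' y, p m (x - y) * F2 y ≤ ENNReal.ofReal (t / 4) := by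
    intro x
    refine (sum_convolution_le_of_le hp hF2le M x).trans ?_
    rw [← ENNReal.ofReal_mul (by positivity)]
    apply ENNReal.ofReal_le_ofReal
    calc 2 * √M * γ ≤ 2 * Q * γ := by gcongr
      _ = t / 4 := by rw [hγ]; field_simp; norm_num
  have hpt : ∀ x, (if ENNReal.ofReal t < ∑' m, wt m * ∑' y, p m (x - y) * F y then 1 else 0 : ℝ≥0∞) ≤
      ENNReal.ofReal (2 / t) * ∑ m ∈ Finset.range M, wt m * ∑' y, p m (x - y) * F1 y := by
    intro x
    split_ifs with h
    swap
    · exact zero_le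
    set H1 := ∑ m ∈ Finset.range M, wt m * ∑' y, p m (x - y) * F1 y
    have hle : ∑' m, wt m * ∑' y, p m (x - y) * F y ≤ H1 + ENNReal.ofReal (t / 2) := by
      rw [tsum_convolution_eq_head_add_tail M hF12]
      refine add_le_add_right ((add_le_add (hhead2 x) (htail x)).trans ?_) _
      rw [← ENNReal.ofReal_add (by positivity) (by positivity)]
      apply ENNReal.ofReal_le_ofReal; linarith
    have h2 : ENNReal.ofReal (t / 2) ≤ H1 := by
      have h3 := (h.trans_le hle).le
      have h4 : ENNReal.ofReal t = ENNReal.ofReal (t/2) + ENNReal.ofReal (t/2) := by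
        rw [← ENNReal.ofReal_add (by positivity) (by positivity)]; congr 1; ring
      rw [h4] at h3
      exact (ENNReal.add_le_add_iff_right ofReal_ne_top).1 h3
    calc (1:ℝ≥0∞) = ENNReal.ofReal (2/t) * ENNReal.ofReal (t/2) := by
          rw [← ENNReal.ofReal_mul (by positivity)]; field_simp; simp
      _ ≤ _ := by gcongr
  have hQe : Q = (4 * C) ^ (b / D) * t ^ (-(b/D)) := by
    rw [hQ, Real.div_rpow ht.le (by positivity), Real.rpow_neg (by positivity : 0 ≤ 4 * C)]
    field_simp
  calc _ ≤ ∑' x, ENNReal.ofReal (2 / t) * ∑ m ∈ Finset.range M, wt m * ∑' y, p m (x - y) * F1 y :=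
        ENNReal.tsum_le_tsum hpt
    _ ≤ ENNReal.ofReal (2 / t) * (ENNReal.ofReal (2 * √M) * ∑' y, F1 y) := by
        rw [ENNReal.tsum_mul_left]
        gcongr
        exact tsum_sum_convolution_le hp F1 M
    _ ≤ ENNReal.ofReal (2 / t) * (ENNReal.ofReal (2 * Q) * ∑' y, F1 y) := by gcongr
    _ ≤ _ := by
      rw [← mul_assoc, ← ENNReal.ofReal_mul (by positivity)]
      refine mul_le_mul (ENNReal.ofReal_le_ofReal (le_of_eq ?_)) (ENNReal.tsum_le_tsum fun y => ?_) (zero_le) (zero_le)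
      · rw [hba, neg_add, Real.rpow_add ht, Real.rpow_neg_one, hQe]; field_simp; ring
      · simp only [hF1]
        by_cases h : ENNReal.ofReal γ < F y
        · rw [if_pos h, if_pos]
          have h8 : ENNReal.ofReal (t ^ (b/a)) = ENNReal.ofReal (2 * (4 * (4 * C) ^ (b/D))) * ENNReal.ofReal γ := by
            rw [← ENNReal.ofReal_mul (by positivity), hγ, hQe, hba, Real.rpow_add ht, Real.rpow_one, Real.rpow_neg ht.le]
            congr 1; field_simp; norm_num
          rw [h8]
          refine (ENNReal.mul_lt_mul_iff_right ?_ ofReal_ne_top).2 h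
          rw [Ne, ENNReal.ofReal_eq_zero, not_le]; positivity
        · rw [if_neg h]; exact zero_le

/-- Hardy-Littlewood-Sobolev inequality for `∑ wt m * (p m * F)`, where the sub-probabilities
`p m` decay like `(m+1)^{-D/2}`. -/
theorem exists_strong_type_bound [Countable ι] (hp : ∀ m, ∑' x, p m x ≤ 1) {B D a b : ℝ} (hB : 0 < B) (ha : 1 < a) (haD : a < D) (hb : 0 < b)
    (hab : 1 / a = 1 / b + 1 / D)
    (hpB : ∀ m x, p m x ≤ ENNReal.ofReal B * ENNReal.ofReal ((m:ℝ)+1) ^ (-(D/2))) :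
    ∃ C : ℝ, 0 < C ∧ ∀ F : ι → ℝ≥0∞, ∑' y, F y ^ a ≤ 1 →
      ∑' x, (∑' m, wt m * ∑' y, p m (x - y) * F y) ^ b ≤ ENNReal.ofReal C := by
  obtain ⟨E, hE, hw⟩ := exists_weak_type_bound hp hB ha.le haD hb hab hpB
  have ha0 : 0 < a := by linarith
  set r := b - b / a with hr
  have hr0 : 0 < r := by
    rw [hr, sub_pos, div_lt_iff₀ ha0]; nlinarith
  refine ⟨b * (E * ((2 * E) ^ (a - 1) / r)), by positivity, ?_⟩
  intro F hF
  set g : ι → ℝ≥0∞ := fun x => ∑' m, wt m * ∑' y, p m (x - y) * F y with hg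
  have hmeas : ∀ v : ℝ≥0∞, Measurable fun t : ℝ => (if ENNReal.ofReal t < v then 1 else 0 : ℝ≥0∞) := fun v =>
    Measurable.ite (measurableSet_lt ENNReal.measurable_ofReal measurable_const) measurable_const measurable_const
  have hpow : ∀ s : ℝ, Measurable fun t : ℝ => ENNReal.ofReal (t ^ s) := fun s => by fun_prop
  have hm : ∀ (s : ℝ) (v : ℝ≥0∞), Measurable fun t : ℝ => ENNReal.ofReal (t ^ s) *
      (if ENNReal.ofReal t < v then 1 else 0 : ℝ≥0∞) := fun s v => (hpow s).mul (hmeas v)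
  have h1 : ∑' x, g x ^ b = ENNReal.ofReal b * ∫⁻ t in Set.Ioi (0:ℝ), ENNReal.ofReal (t ^ (b-1)) *
      ∑' x, (if ENNReal.ofReal t < g x then 1 else 0) := by
    simp_rw [← ENNReal.tsum_mul_left]
    rw [lintegral_tsum fun x => (hm _ _).aemeasurable]
    simp_rw [lintegral_rpow_mul_ite_lt hb]
    rw [← ENNReal.tsum_mul_left]
    congr 1; ext x
    rw [ENNReal.mul_div_cancel (by simpa using hb) ofReal_ne_top]
  have h2 : ∀ t ∈ Set.Ioi (0:ℝ), ENNReal.ofReal (t ^ (b-1)) * ∑' x, (if ENNReal.ofReal t < g x then 1 else 0) ≤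
      ∑' y, ENNReal.ofReal E * F y * (ENNReal.ofReal (t ^ (r-1)) *
        (if ENNReal.ofReal t < (ENNReal.ofReal (2 * E) * F y) ^ (a / b) then 1 else 0)) := by
    intro t (ht : 0 < t)
    calc _ ≤ ENNReal.ofReal (t ^ (b-1)) * (ENNReal.ofReal (E * t ^ (-(b / a))) *
          ∑' y, if ENNReal.ofReal (t ^ (b / a)) < ENNReal.ofReal (2 * E) * F y then F y else 0) := by
          gcongr 1; exact hw F hF t ht
      _ = _ := by
        rw [← ENNReal.tsum_mul_left, ← ENNReal.tsum_mul_left]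
        refine tsum_congr fun y => ?_
        have hiff : ENNReal.ofReal (t ^ (b/a)) < ENNReal.ofReal (2 * E) * F y ↔
            ENNReal.ofReal t < (ENNReal.ofReal (2 * E) * F y) ^ (a / b) := by
          rw [← ENNReal.rpow_lt_rpow_iff (by positivity : 0 < a / b), ENNReal.ofReal_rpow_of_pos (by positivity),
            ← Real.rpow_mul ht.le]
          have : b / a * (a / b) = 1 := by field_simp
          rw [this, Real.rpow_one]
        simp_rw [hiff]
        split_ifs
        · rw [mul_one, ← mul_assoc, ← ENNReal.ofReal_mul (by positivity), mul_right_comm, ← ENNReal.ofReal_mul (by positivity)]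
          congr 2
          rw [mul_left_comm, ← Real.rpow_add ht, hr]; ring_nf
        · simp
  calc _ = _ := h1
    _ ≤ ENNReal.ofReal b * ∫⁻ t in Set.Ioi (0:ℝ), ∑' y, ENNReal.ofReal E * F y * (ENNReal.ofReal (t ^ (r-1)) *
        (if ENNReal.ofReal t < (ENNReal.ofReal (2 * E) * F y) ^ (a / b) then 1 else 0)) := by
        gcongr 1
        exact setLIntegral_mono' measurableSet_Ioi h2
    _ = ENNReal.ofReal b * ∑' y, ENNReal.ofReal E * F y * (((ENNReal.ofReal (2 * E) * F y) ^ (a / b)) ^ r / ENNReal.ofReal r) := by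
        rw [lintegral_tsum fun x => ((hm _ _).const_mul _).aemeasurable]
        congr 2; ext y
        rw [lintegral_const_mul _ (hm _ _), lintegral_rpow_mul_ite_lt hr0]
    _ = ENNReal.ofReal b * ∑' y, ENNReal.ofReal (E * ((2 * E) ^ (a - 1) / r)) * F y ^ a := by
        congr 2; ext y
        have e1 : a / b * r = a - 1 := by rw [hr]; field_simp
        rw [← ENNReal.rpow_mul, e1, ENNReal.mul_rpow_of_nonneg _ _ (by linarith), ENNReal.ofReal_rpow_of_pos (by positivity),
          ENNReal.ofReal_mul hE.le, ENNReal.ofReal_div_of_pos hr0]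
        have e2 : F y ^ a = F y * F y ^ (a - 1) := by
          conv_lhs => rw [show a = 1 + (a - 1) by ring]
          rw [ENNReal.rpow_add_of_nonneg _ _ zero_le_one (by linarith), ENNReal.rpow_one]
        rw [e2]
        simp only [div_eq_mul_inv]
        ring
    _ ≤ ENNReal.ofReal b * (ENNReal.ofReal (E * ((2 * E) ^ (a - 1) / r)) * 1) := by
        rw [ENNReal.tsum_mul_left]; gcongr
    _ = _ := by rw [mul_one, ← ENNReal.ofReal_mul hb.le]

end WeightedConvolution

/-- The symbol `(1/d) ∑ cos ξ_j` of simple random walk. -/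
noncomputable def walkSymbol (d : ℕ) (ξ : Fin d → ℝ) : ℝ := (d:ℝ)⁻¹ * ∑ j, Real.cos (ξ j)

/-- Transition probabilities of simple random walk on `ℤ^d` started at the origin. -/
noncomputable def walkProb (d : ℕ) : ℕ → (Fin d → ℤ) → ℝ
  | 0, x => if x = 0 then 1 else 0
  | m + 1, x => (2 * d : ℝ)⁻¹ * ∑ j, (walkProb d m (x + Pi.single j 1) + walkProb d m (x - Pi.single j 1))

theorem walkProb_nonneg (d m : ℕ) (x : Fin d → ℤ) : 0 ≤ walkProb d m x := by
  induction m generalizing x with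
  | zero => simp only [walkProb]; split_ifs <;> simp
  | succ m ih =>
    rw [walkProb]
    exact mul_nonneg (by positivity) (Finset.sum_nonneg fun j _ => add_nonneg (ih _) (ih _))

theorem tsum_walkProb_le {d : ℕ} (m : ℕ) : ∑' x, ENNReal.ofReal (walkProb d m x) ≤ 1 := by
  induction m with
  | zero =>
    rw [tsum_eq_single 0]
    · simp [walkProb]
    · intro x hx; simp [walkProb, hx]
  | succ m ih =>
    have h : ∀ x, ENNReal.ofReal (walkProb d (m+1) x) = ENNReal.ofReal ((2 * d : ℝ)⁻¹) *
        ∑ j, (ENNReal.ofReal (walkProb d m (x + Pi.single j 1)) + ENNReal.ofReal (walkProb d m (x - Pi.single j 1))) := by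
      intro x
      rw [walkProb, ENNReal.ofReal_mul (by positivity), ENNReal.ofReal_sum_of_nonneg
        fun j _ => add_nonneg (walkProb_nonneg _ _ _) (walkProb_nonneg _ _ _)]
      simp_rw [ENNReal.ofReal_add (walkProb_nonneg _ _ _) (walkProb_nonneg _ _ _)]
    simp_rw [h]
    rw [ENNReal.tsum_mul_left, Summable.tsum_finsetSum (fun _ _ => ENNReal.summable)]
    calc _ ≤ ENNReal.ofReal ((2 * d : ℝ)⁻¹) * ∑ j : Fin d, ((1:ℝ≥0∞) + 1) := by
          gcongr with j _
          rw [ENNReal.tsum_add]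
          gcongr
          · exact ((Equiv.addRight (Pi.single j 1 : Fin d → ℤ)).tsum_eq fun x => ENNReal.ofReal (walkProb d m x)).trans_le ih
          · exact ((Equiv.subRight (Pi.single j 1 : Fin d → ℤ)).tsum_eq fun x => ENNReal.ofReal (walkProb d m x)).trans_le ih
      _ = ENNReal.ofReal ((2 * d : ℝ)⁻¹ * (2 * d)) := by
          rw [ENNReal.ofReal_mul (by positivity)]
          congr 1
          rw [ENNReal.ofReal_mul (by norm_num)]
          simp [one_add_one_eq_two, mul_comm]
      _ ≤ 1 := by
        rw [← ENNReal.ofReal_one]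
        exact ENNReal.ofReal_le_ofReal (inv_mul_le_one)

theorem isCompact_torusBox (d : ℕ) : IsCompact (torusBox d) := isCompact_univ_pi fun _ => isCompact_Icc

theorem volume_restrict_torusBox (d : ℕ) : (volume : Measure (Fin d → ℝ)).restrict (torusBox d) =
    Measure.pi fun _ => volume.restrict (Set.Icc (-Real.pi) Real.pi) := by
  rw [torusBox, volume_pi, Measure.restrict_pi_pi]

/-- The character `ξ ↦ exp(i x·ξ)`. -/
noncomputable def latticeChar {d : ℕ} (x : Fin d → ℤ) (ξ : Fin d → ℝ) : ℂ :=
  Complex.exp (Complex.I * ((∑ j, (x j : ℝ) * ξ j : ℝ) : ℂ))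

theorem norm_latticeChar {d : ℕ} (x : Fin d → ℤ) (ξ : Fin d → ℝ) : ‖latticeChar x ξ‖ = 1 := by
  rw [latticeChar, mul_comm, Complex.norm_exp_ofReal_mul_I]

theorem continuous_latticeChar {d : ℕ} (x : Fin d → ℤ) : Continuous (latticeChar x) := by
  unfold latticeChar; fun_prop

theorem latticeChar_add {d : ℕ} (x y : Fin d → ℤ) (ξ : Fin d → ℝ) :
    latticeChar (x + y) ξ = latticeChar x ξ * latticeChar y ξ := by
  simp only [latticeChar, ← Complex.exp_add, ← mul_add, ← Complex.ofReal_add, ← Finset.sum_add_distrib]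
  congr 3
  refine Finset.sum_congr rfl fun j _ => ?_
  simp; ring

theorem latticeChar_single {d : ℕ} (j : Fin d) (ξ : Fin d → ℝ) (n : ℤ) :
    latticeChar (Pi.single j n) ξ = Complex.exp (Complex.I * (n * ξ j : ℝ)) := by
  rw [latticeChar, Finset.sum_eq_single j]
  · simp
  · intro i _ hi; simp [hi]
  · simp

theorem continuous_walkSymbol (d : ℕ) : Continuous (walkSymbol d) := by
  unfold walkSymbol; fun_prop

theorem latticeChar_mul_walkSymbol {d : ℕ} (x : Fin d → ℤ) (ξ : Fin d → ℝ) :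
    latticeChar x ξ * walkSymbol d ξ =
      (2 * d : ℂ)⁻¹ * ∑ j, (latticeChar (x + Pi.single j 1) ξ + latticeChar (x - Pi.single j 1) ξ) := by
  have h : ∀ j, latticeChar (x + Pi.single j 1) ξ + latticeChar (x - Pi.single j 1) ξ =
      latticeChar x ξ * (2 * Complex.cos (ξ j)) := by
    intro j
    rw [sub_eq_add_neg, ← Pi.single_neg, latticeChar_add, latticeChar_add, latticeChar_single, latticeChar_single,
      Complex.two_cos, ← mul_add]
    congr 2 <;> congr 1 <;> push_cast <;> ring
  simp_rw [h, ← Finset.mul_sum]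
  rw [walkSymbol]
  push_cast
  rw [mul_inv]; ring

theorem integral_Icc_exp (n : ℤ) : ∫ t in Set.Icc (-Real.pi) Real.pi, Complex.exp (Complex.I * ((n * t : ℝ) : ℂ)) =
    if n = 0 then 2 * Real.pi else 0 := by
  rw [integral_Icc_eq_integral_Ioc, ← intervalIntegral.integral_of_le (by linarith [Real.pi_pos])]
  split_ifs with h
  · subst h; simp; ring
  · have hc : (Complex.I * n : ℂ) ≠ 0 := mul_ne_zero Complex.I_ne_zero (by exact_mod_cast h)
    have := integral_exp_mul_complex (a := -Real.pi) (b := Real.pi) hc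
    push_cast
    simp_rw [← mul_assoc]
    rw [this, _root_.div_eq_zero_iff]
    left
    rw [sub_eq_zero, Complex.exp_eq_exp_iff_exists_int]
    exact ⟨n, by push_cast; ring⟩

theorem integral_latticeChar {d : ℕ} (x : Fin d → ℤ) :
    ∫ ξ in torusBox d, latticeChar x ξ = if x = 0 then (2 * Real.pi : ℂ) ^ d else 0 := by
  rw [volume_restrict_torusBox]
  have h : ∀ ξ : Fin d → ℝ, latticeChar x ξ = ∏ j, Complex.exp (Complex.I * ((x j * ξ j : ℝ) : ℂ)) := by
    intro ξ
    rw [latticeChar, ← Complex.exp_sum, Complex.ofReal_sum, Finset.mul_sum]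
  simp_rw [h]
  rw [integral_fintype_prod_eq_prod (fun j t => Complex.exp (Complex.I * ((x j * t : ℝ) : ℂ)))]
  simp_rw [integral_Icc_exp]
  split_ifs with h0
  · subst h0; simp
  · obtain ⟨j, hj⟩ := Function.ne_iff.1 h0
    have hj' : x j ≠ 0 := hj
    exact Finset.prod_eq_zero (Finset.mem_univ j) (by simp [hj'])

theorem integrableOn_latticeChar_mul {d : ℕ} (x : Fin d → ℤ) (m : ℕ) :
    IntegrableOn (fun ξ => latticeChar x ξ * (walkSymbol d ξ : ℂ) ^ m) (torusBox d) := by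
  apply Continuous.continuousOn _ |>.integrableOn_compact (isCompact_torusBox d)
  have := continuous_latticeChar x
  have := continuous_walkSymbol d
  fun_prop

/-- Random walk transition probabilities are the Fourier coefficients of powers of the symbol. -/
theorem integral_latticeChar_mul_pow {d : ℕ} (m : ℕ) (x : Fin d → ℤ) :
    ((2 * Real.pi : ℂ) ^ d)⁻¹ * ∫ ξ in torusBox d, latticeChar x ξ * (walkSymbol d ξ : ℂ) ^ m = walkProb d m x := by
  induction m generalizing x with
  | zero =>
    have : ((2 * Real.pi : ℂ) ^ d) ≠ 0 := by
      simp [Real.pi_ne_zero]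
    simp only [pow_zero, mul_one, integral_latticeChar, walkProb]
    split_ifs <;> simp [this]
  | succ m ih =>
    have h : ∀ ξ, latticeChar x ξ * (walkSymbol d ξ : ℂ) ^ (m+1) = (2 * d : ℂ)⁻¹ *
        ∑ j, (latticeChar (x + Pi.single j 1) ξ * (walkSymbol d ξ : ℂ) ^ m +
          latticeChar (x - Pi.single j 1) ξ * (walkSymbol d ξ : ℂ) ^ m) := by
      intro ξ
      rw [pow_succ', ← mul_assoc, latticeChar_mul_walkSymbol, mul_assoc, Finset.sum_mul]
      simp_rw [add_mul]
    simp_rw [h]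
    rw [integral_const_mul, integral_finsetSum]
    · simp_rw [fun j => integral_add (integrableOn_latticeChar_mul (x + Pi.single j 1) m) (integrableOn_latticeChar_mul (x - Pi.single j 1) m)]
      rw [mul_left_comm, Finset.mul_sum]
      simp_rw [mul_add, ih]
      rw [walkProb]; push_cast; rfl
    · intro j _
      exact (integrableOn_latticeChar_mul (x + Pi.single j 1) m).add (integrableOn_latticeChar_mul (x - Pi.single j 1) m)

theorem integral_exp_neg_mul_sin_sq_le {s : ℝ} (hs : 0 < s) :
    ∫ t in Set.Icc (-Real.pi) Real.pi, Real.exp (-s * Real.sin t ^ 2) ≤ 3 * Real.sqrt (Real.pi / (4 / Real.pi ^ 2 * s)) := by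
  have hpi := Real.pi_pos
  set c := 4 / Real.pi ^ 2 * s with hc
  have hc0 : 0 < c := by positivity
  set G : ℝ → ℝ := fun t => Real.exp (-c * t ^ 2)
  have hGi : Integrable G := integrable_exp_neg_mul_sq hc0
  have hG0 : ∀ t, 0 ≤ G t := fun t => (Real.exp_pos _).le
  have key : ∀ t u : ℝ, |u| ≤ Real.pi / 2 → Real.sin t ^ 2 = Real.sin u ^ 2 → Real.exp (-s * Real.sin t ^ 2) ≤ G u := by
    intro t u hu htu
    apply Real.exp_le_exp.2
    have h1 := Real.mul_abs_le_abs_sin hu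
    have h2 : (2 / Real.pi * |u|) ^ 2 ≤ Real.sin u ^ 2 := by
      rw [← sq_abs (Real.sin u)]; gcongr
    rw [mul_pow, sq_abs, div_pow] at h2
    rw [htu, hc]
    nlinarith
  have hint : Integrable fun t => G t + G (t - Real.pi) + G (t + Real.pi) :=
    (hGi.add (hGi.comp_sub_right Real.pi)).add (hGi.comp_add_right Real.pi)
  calc _ ≤ ∫ t in Set.Icc (-Real.pi) Real.pi, (G t + G (t - Real.pi) + G (t + Real.pi)) := by
        apply setIntegral_mono_on _ hint.integrableOn measurableSet_Icc
        · intro t ht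
          have := hG0 t
          have := hG0 (t - Real.pi)
          have := hG0 (t + Real.pi)
          rcases le_total t (-(Real.pi / 2)) with h | h
          · have := key t (t + Real.pi) (abs_le.2 ⟨by linarith [ht.1], by linarith⟩) (by rw [Real.sin_add_pi, neg_sq])
            linarith
          · rcases le_total t (Real.pi / 2) with h' | h'
            · have := key t t (abs_le.2 ⟨h, h'⟩) rfl
              linarith
            · have := key t (t - Real.pi) (abs_le.2 ⟨by linarith, by linarith [ht.2]⟩) (by rw [Real.sin_sub_pi, neg_sq])
              linarith
        · exact (Continuous.continuousOn (by fun_prop)).integrableOn_compact isCompact_Icc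
    _ ≤ ∫ t, (G t + G (t - Real.pi) + G (t + Real.pi)) :=
        setIntegral_le_integral hint (Filter.Eventually.of_forall fun t => by
          have := hG0 t
          have := hG0 (t - Real.pi)
          have := hG0 (t + Real.pi)
          simp only [Pi.zero_apply]; linarith)
    _ = _ := by
      have h1 : Integrable fun t => G (t - Real.pi) := hGi.comp_sub_right Real.pi
      have h2 : Integrable fun t => G (t + Real.pi) := hGi.comp_add_right Real.pi
      have h3 : Integrable fun t => G t + G (t - Real.pi) := hGi.add h1
      rw [integral_add h3 h2, integral_add hGi h1, integral_sub_right_eq_self, integral_add_right_eq_self,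
        integral_gaussian]
      ring

/-- The symbol has modulus one only where every `sin ξ_j` vanishes. -/
theorem abs_walkSymbol_le {d : ℕ} (hd : 0 < d) (ξ : Fin d → ℝ) :
    |walkSymbol d ξ| ≤ 1 - (2 * d : ℝ)⁻¹ * ∑ j, Real.sin (ξ j) ^ 2 := by
  have hd0 : (0:ℝ) < d := by exact_mod_cast hd
  rw [walkSymbol, abs_mul, abs_of_pos (by positivity)]
  calc _ ≤ (d:ℝ)⁻¹ * ∑ j, (1 - Real.sin (ξ j) ^ 2 / 2) := by
        gcongr
        refine (Finset.abs_sum_le_sum_abs _ _).trans (Finset.sum_le_sum fun j _ => ?_)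
        rw [Real.sin_sq, ← sq_abs (Real.cos (ξ j))]
        nlinarith [sq_nonneg (1 - |Real.cos (ξ j)|)]
    _ = _ := by
      rw [Finset.sum_sub_distrib, ← Finset.sum_div]
      simp only [Finset.sum_const, Finset.card_univ, Fintype.card_fin, nsmul_eq_mul, mul_one]
      field_simp

theorem abs_walkSymbol_pow_le {d : ℕ} (hd : 0 < d) (m : ℕ) (ξ : Fin d → ℝ) :
    |walkSymbol d ξ| ^ m ≤ Real.exp (1/2) * ∏ j, Real.exp (-(((m:ℝ)+1) / (2 * d)) * Real.sin (ξ j) ^ 2) := by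
  have hd0 : (0:ℝ) < d := by exact_mod_cast hd
  rw [← Real.exp_sum, ← Real.exp_add, ← Finset.mul_sum]
  set S := ∑ j, Real.sin (ξ j) ^ 2
  have hS : S ≤ d := by
    calc S ≤ ∑ j : Fin d, (1:ℝ) := Finset.sum_le_sum fun j _ => Real.sin_sq_le_one _
      _ = d := by simp
  have h1 : |walkSymbol d ξ| ≤ Real.exp (-((2 * d : ℝ)⁻¹ * S)) := by
    have h2 := Real.add_one_le_exp (-((2 * d : ℝ)⁻¹ * S))
    linarith [abs_walkSymbol_le hd ξ]
  calc _ ≤ Real.exp (-((2 * d : ℝ)⁻¹ * S)) ^ m := by gcongr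
    _ ≤ _ := by
      rw [← Real.exp_nat_mul]
      apply Real.exp_le_exp.2
      have : (2 * d : ℝ)⁻¹ * S ≤ 1/2 := by
        rw [inv_mul_le_iff₀ (by positivity)]; linarith
      have e : -(((m:ℝ) + 1) / (2 * d)) * S = - m * ((2 * d : ℝ)⁻¹ * S) - (2 * d : ℝ)⁻¹ * S := by ring
      rw [e]; linarith

theorem integral_abs_walkSymbol_pow_le {d : ℕ} (hd : 0 < d) :
    ∃ B : ℝ, 0 < B ∧ ∀ m : ℕ, ∫ ξ in torusBox d, |walkSymbol d ξ| ^ m ≤ B * ((m:ℝ)+1) ^ (-((d:ℝ)/2)) := by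
  have hd0 : (0:ℝ) < d := by exact_mod_cast hd
  have hpi := Real.pi_pos
  refine ⟨Real.exp (1/2) * (3 * Real.sqrt (Real.pi / (4 / Real.pi ^ 2 * (1 / (2 * d))))) ^ d, by positivity, ?_⟩
  intro m
  have hcs := continuous_walkSymbol d
  calc _ ≤ ∫ ξ in torusBox d, Real.exp (1/2) * ∏ j, Real.exp (-(((m:ℝ)+1) / (2 * d)) * Real.sin (ξ j) ^ 2) := by
        apply setIntegral_mono_on _ _ (isCompact_torusBox d).measurableSet fun ξ _ => abs_walkSymbol_pow_le hd m ξ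
        · exact (Continuous.continuousOn (by fun_prop)).integrableOn_compact (isCompact_torusBox d)
        · exact (Continuous.continuousOn (by fun_prop)).integrableOn_compact (isCompact_torusBox d)
    _ = Real.exp (1/2) * (∫ t in Set.Icc (-Real.pi) Real.pi, Real.exp (-(((m:ℝ)+1) / (2 * d)) * Real.sin t ^ 2)) ^ d := by
        rw [integral_const_mul, volume_restrict_torusBox,
          integral_fintype_prod_eq_pow (fun t => Real.exp (-(((m:ℝ)+1) / (2 * d)) * Real.sin t ^ 2)), Fintype.card_fin]
    _ ≤ Real.exp (1/2) * (3 * Real.sqrt (Real.pi / (4 / Real.pi ^ 2 * (((m:ℝ)+1) / (2 * d))))) ^ d := by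
        gcongr
        exact integral_exp_neg_mul_sin_sq_le (by positivity)
    _ = _ := by
      have e1 : Real.pi / (4 / Real.pi ^ 2 * (((m:ℝ)+1) / (2 * d))) =
          Real.pi / (4 / Real.pi ^ 2 * (1 / (2 * d))) * ((m:ℝ)+1)⁻¹ := by field_simp
      rw [e1, Real.sqrt_mul (by positivity), ← mul_assoc, mul_pow _ (Real.sqrt ((m:ℝ)+1)⁻¹), ← mul_assoc]
      congr 1
      rw [Real.sqrt_eq_rpow, Real.inv_rpow (by positivity), ← Real.rpow_neg (by positivity), ← Real.rpow_mul_natCast (by positivity)]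
      congr 1; ring

theorem walkProb_le {d : ℕ} (hd : 0 < d) : ∃ B : ℝ, 0 < B ∧ ∀ m x,
    ENNReal.ofReal (walkProb d m x) ≤ ENNReal.ofReal B * ENNReal.ofReal ((m:ℝ)+1) ^ (-((d:ℝ)/2)) := by
  obtain ⟨B, hB, h⟩ := integral_abs_walkSymbol_pow_le hd
  have hpi := Real.pi_pos
  refine ⟨((2 * Real.pi) ^ d)⁻¹ * B, by positivity, fun m x => ?_⟩
  rw [ENNReal.ofReal_rpow_of_pos (by positivity), ← ENNReal.ofReal_mul (by positivity)]
  apply ENNReal.ofReal_le_ofReal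
  rw [mul_assoc]
  calc walkProb d m x ≤ ‖(walkProb d m x : ℂ)‖ := by rw [Complex.norm_real]; exact Real.le_norm_self _
    _ ≤ ((2 * Real.pi) ^ d)⁻¹ * ∫ ξ in torusBox d, |walkSymbol d ξ| ^ m := by
      rw [← integral_latticeChar_mul_pow, norm_mul]
      have e : ‖((2 * Real.pi : ℂ) ^ d)⁻¹‖ = ((2 * Real.pi) ^ d)⁻¹ := by
        simp [abs_of_pos hpi]
      rw [e]
      gcongr
      refine (norm_integral_le_integral_norm _).trans (le_of_eq ?_)
      simp [norm_latticeChar]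
    _ ≤ _ := by gcongr; exact h m

theorem ae_abs_walkSymbol_lt_one {d : ℕ} (hd : 0 < d) :
    ∀ᵐ ξ ∂(volume.restrict (torusBox d)), |walkSymbol d ξ| < 1 := by
  apply ae_restrict_of_ae
  have hd0 : (0:ℝ) < d := by exact_mod_cast hd
  have hz : ∀ᵐ t : ℝ, Real.sin t ≠ 0 := by
    rw [ae_iff]
    have : {t : ℝ | ¬ Real.sin t ≠ 0} ⊆ Set.range fun n : ℤ => (n:ℝ) * Real.pi := by
      intro t ht
      simp only [Set.mem_ofPred_eq, not_not] at ht
      exact Real.sin_eq_zero_iff.1 ht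
    exact measure_mono_null this ((Set.countable_range _).measure_zero _)
  have h : ∀ᵐ ξ : Fin d → ℝ, Real.sin (ξ ⟨0, hd⟩) ≠ 0 :=
    (Measure.quasiMeasurePreserving_eval (fun _ : Fin d => (volume : Measure ℝ)) ⟨0, hd⟩).ae hz
  filter_upwards [h] with ξ hξ
  have hpos : 0 < Real.sin (ξ ⟨0, hd⟩) ^ 2 := sq_pos_of_ne_zero hξ
  have h1 : 0 < ∑ j, Real.sin (ξ j) ^ 2 :=
    hpos.trans_le (Finset.single_le_sum (f := fun j => Real.sin (ξ j) ^ 2)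
      (fun _ _ => sq_nonneg _) (Finset.mem_univ _))
  have h2 : 0 < (2 * d : ℝ)⁻¹ * ∑ j, Real.sin (ξ j) ^ 2 := mul_pos (by positivity) h1
  linarith [abs_walkSymbol_le hd ξ]

theorem discOmega_eq {d : ℕ} (hd : 0 < d) (ξ : Fin d → ℝ) :
    discOmega d ξ = √(2 * d) * √(1 - walkSymbol d ξ) := by
  have hd0 : (0:ℝ) < d := by exact_mod_cast hd
  rw [discOmega, ← Real.sqrt_mul (by positivity), walkSymbol, Finset.sum_sub_distrib, ← Finset.mul_sum]
  congr 1
  simp only [Finset.sum_const, Finset.card_univ, Fintype.card_fin, nsmul_eq_mul]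
  field_simp

/-- The kernel of `(-Δ)^{-1/2}` is dominated by the weighted sum of the transition probabilities. -/
theorem enorm_invSqrtLapKernel_le {d : ℕ} (hd : 2 ≤ d) (x : Fin d → ℤ) :
    ‖invSqrtLapKernel d x‖ₑ ≤ ∑' m, wt m * ENNReal.ofReal (walkProb d m x) := by
  have hd' : 0 < d := by omega
  have hd0 : (2:ℝ) ≤ d := by exact_mod_cast hd
  obtain ⟨B, hB, hA⟩ := integral_abs_walkSymbol_pow_le hd'
  set c : ℕ → ℝ := fun n => Ring.choose ((1/2:ℝ) + n - 1) n with hc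
  have hc0 : ∀ n, 0 ≤ c n := fun n => (choose_half_nonneg_and_sq_mul_le n).1
  set Φ : ℕ → (Fin d → ℝ) → ℂ := fun m ξ => (c m : ℂ) * (latticeChar x ξ * (walkSymbol d ξ : ℂ) ^ m) with hΦ
  have hnorm : ∀ m, ∫ ξ in torusBox d, ‖Φ m ξ‖ = c m * ∫ ξ in torusBox d, |walkSymbol d ξ| ^ m := by
    intro m
    rw [← integral_const_mul]
    congr 1; ext ξ
    simp [hΦ, norm_latticeChar, abs_of_nonneg (hc0 m)]
  have hsum : Summable fun m => ∫ ξ in torusBox d, ‖Φ m ξ‖ := by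
    have hs : Summable fun m : ℕ => B * ((m:ℝ)+1) ^ (-(3/2):ℝ) := by
      apply Summable.mul_left
      have := (summable_nat_add_iff 1).2 (Real.summable_nat_rpow.2 (by norm_num : (-(3/2):ℝ) < -1))
      simpa using this
    refine hs.of_nonneg_of_le (fun m => integral_nonneg fun _ => norm_nonneg _) fun m => ?_
    rw [hnorm]
    calc _ ≤ ((m:ℝ)+1) ^ (-(1/2):ℝ) * (B * ((m:ℝ)+1) ^ (-((d:ℝ)/2))) :=
          mul_le_mul (choose_half_le_rpow m) (hA m) (integral_nonneg fun _ => by positivity) (by positivity)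
      _ = B * ((m:ℝ)+1) ^ (-(1/2) + -((d:ℝ)/2)) := by
          rw [Real.rpow_add (by positivity)]; ring
      _ ≤ _ := by
        gcongr
        · linarith [(Nat.cast_nonneg m : (0:ℝ) ≤ m)]
        · linarith
  have hint : ∀ m, Integrable (Φ m) (volume.restrict (torusBox d)) := fun m =>
    (integrableOn_latticeChar_mul x m).const_mul _
  have hmain := hasSum_integral_of_summable_integral_norm hint hsum
  have hK : invSqrtLapKernel d x = ((√(2 * d))⁻¹ : ℝ) * ∑' m, ((c m : ℂ) * walkProb d m x) := by
    have h1 : ∀ m, (c m : ℂ) * walkProb d m x = ((2 * Real.pi : ℂ) ^ d)⁻¹ * ∫ ξ in torusBox d, Φ m ξ := by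
      intro m
      rw [← integral_latticeChar_mul_pow, hΦ, integral_const_mul]; ring
    simp_rw [h1]
    rw [tsum_mul_left, hmain.tsum_eq, invSqrtLapKernel, mul_left_comm]
    congr 1
    rw [← integral_const_mul]
    apply integral_congr_ae
    filter_upwards [ae_abs_walkSymbol_lt_one hd'] with ξ hξ
    have h2 := ((Complex.hasSum_ofReal.2 (hasSum_inv_sqrt_one_sub hξ)).mul_left (latticeChar x ξ)).tsum_eq
    have h3 : ∑' m, Φ m ξ = latticeChar x ξ * ((√(1 - walkSymbol d ξ))⁻¹ : ℝ) := by
      rw [← h2]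
      refine tsum_congr fun m => ?_
      simp only [hΦ, hc]; push_cast; ring
    rw [h3, discOmega_eq hd', ← latticeChar]
    push_cast
    rw [mul_inv]; ring
  rw [hK, enorm_mul]
  have hle1 : ‖(((√(2 * d))⁻¹ : ℝ) : ℂ)‖ₑ ≤ 1 := by
    rw [← ofReal_norm, Complex.norm_real, ← ENNReal.ofReal_one, Real.norm_of_nonneg (by positivity)]
    apply ENNReal.ofReal_le_ofReal
    apply inv_le_one_of_one_le₀
    rw [Real.one_le_sqrt]; linarith
  calc _ ≤ 1 * ∑' m, ‖(c m : ℂ) * walkProb d m x‖ₑ := by gcongr; exact enorm_tsum_le_tsum_enorm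
    _ ≤ _ := by
      rw [one_mul]
      refine ENNReal.tsum_le_tsum fun m => ?_
      rw [enorm_mul, ← ofReal_norm, ← ofReal_norm, Complex.norm_real, Complex.norm_real,
        Real.norm_of_nonneg (hc0 m), Real.norm_of_nonneg (walkProb_nonneg d m x), wt, ENNReal.ofReal_rpow_of_pos (by positivity)]
      gcongr
      exact choose_half_le_rpow m

/-- Convolution with the kernel of `(-Δ)^{-1/2}` is dominated by the weighted sum of the random walk
operators. -/
theorem enorm_tsum_invSqrtLapKernel_mul_le {d : ℕ} (hd : 2 ≤ d) (f : (Fin d → ℤ) → ℂ) (x : Fin d → ℤ) :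
    ‖∑' y, invSqrtLapKernel d (x - y) * f y‖ₑ ≤
      ∑' m, wt m * ∑' y, ENNReal.ofReal (walkProb d m (x - y)) * ‖f y‖ₑ := by
  calc _ ≤ ∑' y, ‖invSqrtLapKernel d (x - y) * f y‖ₑ := enorm_tsum_le_tsum_enorm
    _ ≤ ∑' y, (∑' m, wt m * ENNReal.ofReal (walkProb d m (x - y))) * ‖f y‖ₑ := by
      refine ENNReal.tsum_le_tsum fun y => ?_
      rw [enorm_mul]
      gcongr
      exact enorm_invSqrtLapKernel_le hd _
    _ = _ := by
      simp_rw [← ENNReal.tsum_mul_right, ← ENNReal.tsum_mul_left]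
      rw [ENNReal.tsum_comm]
      simp_rw [mul_assoc]

theorem lpNorm_ofReal (d : ℕ) {p : ℝ} (hp : 0 < p) (f : (Fin d → ℤ) → ℂ) :
    lpNorm d (ENNReal.ofReal p) f = (∑' x, ‖f x‖ₑ ^ p) ^ (1 / p) := by
  change eLpNorm f _ Measure.count = _
  rw [eLpNorm_eq_lintegral_rpow_enorm_toReal (by simpa using hp) ofReal_ne_top,
    ENNReal.toReal_ofReal hp.le, lintegral_count]

/-- The `l^a` unit ball increases with `a`. -/
theorem ENNReal.tsum_rpow_le_one_of_le {ι : Type*} {G : ι → ℝ≥0∞} {a a' : ℝ} (ha : 0 < a) (haa' : a ≤ a')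
    (hG : ∑' y, G y ^ a ≤ 1) : ∑' y, G y ^ a' ≤ 1 := by
  refine (ENNReal.tsum_le_tsum fun y => ?_).trans hG
  refine ENNReal.rpow_le_rpow_of_exponent_ge ?_ haa'
  have h := (ENNReal.le_tsum y).trans hG
  rwa [← ENNReal.one_rpow a, ENNReal.rpow_le_rpow_iff ha] at h

/-- A positively homogeneous operator bounded on the `l^a` unit ball is bounded from `l^a` to `l^b`. -/
theorem tsum_rpow_le_of_unit_ball {ι : Type*} [AddCommGroup ι] {p : ℕ → ι → ℝ≥0∞} {a b C : ℝ}
    (ha : 0 < a) (hb : 0 < b) (hC : 0 < C)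
    (h : ∀ F : ι → ℝ≥0∞, ∑' y, F y ^ a ≤ 1 →
      ∑' x, (∑' m, wt m * ∑' y, p m (x - y) * F y) ^ b ≤ ENNReal.ofReal C) (F : ι → ℝ≥0∞) :
    (∑' x, (∑' m, wt m * ∑' y, p m (x - y) * F y) ^ b) ^ (1 / b) ≤
      ENNReal.ofReal (C ^ (1 / b)) * (∑' y, F y ^ a) ^ (1 / a) := by
  set A := (∑' y, F y ^ a) ^ (1 / a) with hA
  have hAa : ∑' y, F y ^ a = A ^ a := by
    rw [hA, ← ENNReal.rpow_mul, one_div_mul_cancel ha.ne', ENNReal.rpow_one]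
  rcases eq_or_ne A ⊤ with hAt | hAt
  · rw [hAt, ENNReal.mul_top]
    · exact le_top
    · rw [Ne, ENNReal.ofReal_eq_zero, not_le]; positivity
  rcases eq_or_ne A 0 with hA0 | hA0
  · have hF : ∀ y, F y = 0 := by
      rw [hA0, ENNReal.zero_rpow_of_pos ha, ENNReal.tsum_eq_zero] at hAa
      exact fun y => (ENNReal.rpow_eq_zero_iff_of_pos ha).1 (hAa y)
    simp [hF, ENNReal.zero_rpow_of_pos hb, hb]
  have hG : ∑' y, (A⁻¹ * F y) ^ a ≤ 1 := by
    simp_rw [ENNReal.mul_rpow_of_nonneg _ _ ha.le]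
    rw [ENNReal.tsum_mul_left, hAa, ← ENNReal.mul_rpow_of_nonneg _ _ ha.le, ENNReal.inv_mul_cancel hA0 hAt,
      ENNReal.one_rpow]
  have hF : ∀ y, F y = A * (A⁻¹ * F y) := fun y => by
    rw [← mul_assoc, ENNReal.mul_inv_cancel hA0 hAt, one_mul]
  have hT : ∀ x, ∑' m, wt m * ∑' y, p m (x - y) * F y =
      A * ∑' m, wt m * ∑' y, p m (x - y) * (A⁻¹ * F y) := by
    intro x
    have hm : ∀ m, ∑' y, p m (x - y) * F y = A * ∑' y, p m (x - y) * (A⁻¹ * F y) := fun m => by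
      rw [← ENNReal.tsum_mul_left]
      refine tsum_congr fun y => ?_
      rw [mul_left_comm, ← hF]
    simp_rw [hm, mul_left_comm _ A]
    rw [ENNReal.tsum_mul_left]
  simp_rw [hT, ENNReal.mul_rpow_of_nonneg _ _ hb.le]
  rw [ENNReal.tsum_mul_left, ENNReal.mul_rpow_of_nonneg _ _ (by positivity), ← ENNReal.rpow_mul,
    mul_one_div_cancel hb.ne', ENNReal.rpow_one, mul_comm, ← ENNReal.ofReal_rpow_of_pos hC]
  gcongr
  exact h _ hG

/-- `l^a → l^b` boundedness of `(-Δ)^{-1/2}` on `ℤ^d` for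
`b > d/(d-1)` and `1 ≤ a ≤ bd/(b+d)`. -/
theorem invSqrtLap_bounded (d : ℕ) (hd : 2 ≤ d) (a b : ℝ)
    (hb : (d : ℝ) / (d - 1) < b) (ha1 : 1 ≤ a) (ha2 : a ≤ b * d / (b + d)) :
    ∃ C : ℝ, 0 < C ∧
      ∀ f : (Fin d → ℤ) → ℂ,
        lpNorm d (ENNReal.ofReal b)
            (fun x => ∑' y : Fin d → ℤ, invSqrtLapKernel d (x - y) * f y)
          ≤ ENNReal.ofReal C * lpNorm d (ENNReal.ofReal a) f := by
  have hd2 : (2:ℝ) ≤ d := by exact_mod_cast hd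
  have hd1 : (0:ℝ) < d - 1 := by linarith
  have hd0 : (0:ℝ) < d := by linarith
  have hb0 : 0 < b := lt_trans (by positivity) hb
  have ha0 : 0 < a := by linarith
  rw [div_lt_iff₀ hd1] at hb
  have hlt : 1 < b * d / (b + d) := by rw [one_lt_div (by positivity)]; linarith
  have hltd : b * d / (b + d) < d := by rw [div_lt_iff₀ (by positivity)]; nlinarith
  have hinv : 1 / (b * d / (b + d)) = 1 / b + 1 / d := by field_simp; ring
  obtain ⟨B, hB, hp⟩ := walkProb_le (d := d) (by omega)
  obtain ⟨C, hC, h⟩ := exists_strong_type_bound (p := fun m x => ENNReal.ofReal (walkProb d m x)) tsum_walkProb_le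
    hB hlt hltd hb0 hinv hp
  refine ⟨C ^ (1 / b), by positivity, fun f => ?_⟩
  rw [lpNorm_ofReal d hb0, lpNorm_ofReal d ha0]
  have hscaled := tsum_rpow_le_of_unit_ball
    (p := fun m x => ENNReal.ofReal (walkProb d m x)) ha0 hb0 hC
    (fun F hF => h F (ENNReal.tsum_rpow_le_one_of_le ha0 ha2 hF)) fun y => ‖f y‖ₑ
  refine le_trans (ENNReal.rpow_le_rpow (ENNReal.tsum_le_tsum fun x => ?_) (by positivity)) hscaled
  exact ENNReal.rpow_le_rpow (enorm_tsum_invSqrtLapKernel_mul_le hd f x) hb0.le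
end
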